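/- Let n ∈ ℕ and 0 < r < q ≤ 1. If F ∈ 𝓡̄_n(q) is not extremal, then F *_q^n R_n(r;z) ∈ 𝓡_n(r); if F ∈ 𝓝̄_n(q) is not extremal, then F *_q^n R_n(r;z) ∈ 𝓝_n(r). -/

import Mathlib

open Polynomial Filter

open scoped Classical

noncomputable section

/-- `R_n(q;z) = ∏_{j=1}^n (1 + q^{j-1} z)`, the generating polynomial of the
q-binomial coefficients. -/
def Rpoly (n : ℕ) (q : ℝ) : Polynomial ℝ :=
  ∏ j ∈ Finset.range n, (1 + Polynomial.C (q ^ j) * Polynomial.X)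

/-- The q-binomial coefficient `C_k^n(q)`. -/
def qBinom (n k : ℕ) (q : ℝ) : ℝ := (Rpoly n q).coeff k

/-- The weighted Hadamard product `F *_q^n G`: if `F = ∑ C_k^n(q) a_k z^k` and
`G = ∑ C_k^n(q) b_k z^k`, then `F *_q^n G = ∑ C_k^n(q) a_k b_k z^k`. -/
def qHadamard (n : ℕ) (q : ℝ) (F G : Polynomial ℝ) : Polynomial ℝ :=
  ∑ k ∈ Finset.range (n + 1),
    Polynomial.C (F.coeff k * G.coeff k / qBinom n k q) * Polynomial.X ^ k

/-- All zeros of the real polynomial `F` are real (it splits over `ℝ`). -/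
def RealRooted (F : Polynomial ℝ) : Prop :=
  F = 0 ∨ F.roots.card = F.natDegree

/-- All real roots of `F` are nonpositive. -/
def OnlyNonposRoots (F : Polynomial ℝ) : Prop := ∀ x ∈ F.roots, x ≤ 0

/-- The multiset `s` (of zeros, with multiplicity) is logarithmically q-separated. -/
def LogSep (q : ℝ) (s : Multiset ℝ) : Prop :=
  (∀ x ∈ s, x ≠ 0 → 2 ≤ s.count x → (1 : ℝ) ≤ q) ∧
  (∀ x ∈ s, ∀ y ∈ s, ((y < x ∧ x < 0) ∨ (0 < x ∧ x < y)) → x / y ≤ q)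

/-- The multiset `s` (of zeros, with multiplicity) is strictly logarithmically
q-separated. -/
def StrictLogSep (q : ℝ) (s : Multiset ℝ) : Prop :=
  (∀ x ∈ s, x ≠ 0 → 2 ≤ s.count x → (1 : ℝ) < q) ∧
  (∀ x ∈ s, ∀ y ∈ s, ((y < x ∧ x < 0) ∨ (0 < x ∧ x < y)) → x / y < q)

/-- The class `𝓡̄_n(q)`. -/
def memRbar (n : ℕ) (q : ℝ) (F : Polynomial ℝ) : Prop :=
  F.natDegree ≤ n ∧ RealRooted F ∧ LogSep q F.roots

/-- The class `𝓡_n(q)`. -/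
def memR (n : ℕ) (q : ℝ) (F : Polynomial ℝ) : Prop :=
  F.natDegree ≤ n ∧ RealRooted F ∧ StrictLogSep q F.roots

/-- The class `𝓝̄_n(q)`. -/
def memNbar (n : ℕ) (q : ℝ) (F : Polynomial ℝ) : Prop :=
  memRbar n q F ∧ OnlyNonposRoots F

/-- The class `𝓝_n(q)`. -/
def memN (n : ℕ) (q : ℝ) (F : Polynomial ℝ) : Prop :=
  memR n q F ∧ OnlyNonposRoots F

/-- `F ≼ G` : both have only real zeros and `F'G - FG' ≤ 0` on `ℝ`. -/
def Prec (F G : Polynomial ℝ) : Prop :=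
  RealRooted F ∧ RealRooted G ∧
    ∀ x : ℝ, (Polynomial.derivative F * G - F * Polynomial.derivative G).eval x ≤ 0

/-- `F ≺ G` : `F ≼ G` and no common zeros. -/
def PrecS (F G : Polynomial ℝ) : Prop :=
  Prec F G ∧ ∀ x : ℝ, ¬ (F.eval x = 0 ∧ G.eval x = 0)

/-- `F ≺₀ G` : `F ≼ G` and no common zeros except possibly at the origin. -/
def Prec0 (F G : Polynomial ℝ) : Prop :=
  Prec F G ∧ ∀ x : ℝ, x ≠ 0 → ¬ (F.eval x = 0 ∧ G.eval x = 0)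

/-- `F ⋎ G` : `G ≼ zF`. -/
def Veebar (F G : Polynomial ℝ) : Prop := Prec G (Polynomial.X * F)

/-- `F ∨ G` : `F ⋎ G` and no common zeros except possibly at the origin. -/
def VeeS (F G : Polynomial ℝ) : Prop :=
  Veebar F G ∧ ∀ x : ℝ, x ≠ 0 → ¬ (F.eval x = 0 ∧ G.eval x = 0)

/-- `F ⊴ G` : `F ⋎ G` for polynomials with only nonpositive zeros. -/
def TriLE (F G : Polynomial ℝ) : Prop :=
  OnlyNonposRoots F ∧ OnlyNonposRoots G ∧ Veebar F G

/-- `F ◁ G` : `F ∨ G` for polynomials with only nonpositive zeros. -/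
def TriLT (F G : Polynomial ℝ) : Prop :=
  OnlyNonposRoots F ∧ OnlyNonposRoots G ∧ VeeS F G

/-- `F` is extremal (in `𝓡̄_n(q)` or `𝓝̄_n(q)`): `F(z) = c · R_n(q; a z)` for
nonzero reals `a`, `c`. -/
def Extremal (n : ℕ) (q : ℝ) (F : Polynomial ℝ) : Prop :=
  ∃ a c : ℝ, a ≠ 0 ∧ c ≠ 0 ∧
    F = Polynomial.C c * (Rpoly n q).comp (Polynomial.C a * Polynomial.X)

/-- The q-difference operator `Δ_{q,n}`. -/
def qDelta (q : ℝ) (n : ℕ) (F : Polynomial ℝ) : Polynomial ℝ :=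
  if q = 1 then Polynomial.C ((n : ℝ)⁻¹) * Polynomial.derivative F
  else Polynomial.C (q ^ (n - 1) - q⁻¹)⁻¹ *
    (F - F.comp (Polynomial.C q⁻¹ * Polynomial.X)).divX

/-- The operator `Δ*_{q,n}`. -/
def qDeltaStar (q : ℝ) (n : ℕ) (F : Polynomial ℝ) : Polynomial ℝ :=
  if q = 1 then F - Polynomial.C ((n : ℝ)⁻¹) * (Polynomial.X * Polynomial.derivative F)
  else Polynomial.C (q⁻¹ ^ n - 1)⁻¹ *
    (Polynomial.C (q⁻¹ ^ n) * F - F.comp (Polynomial.C q⁻¹ * Polynomial.X))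

/-- The sequence `a_0, …, a_n` is strictly log-concave (`𝓛𝓒_n`):
`a_k² > a_{k-1} a_{k+1}` for every `k` for which there are `l ≤ k` and `m ≥ k`
with `a_l ≠ 0 ≠ a_m` (with the convention `a_{-1} = 0`). -/
def LCcond (n : ℕ) (a : ℕ → ℝ) : Prop :=
  ∀ k ≤ n, (∃ l, l ≤ k ∧ a l ≠ 0) → (∃ m, k ≤ m ∧ m ≤ n ∧ a m ≠ 0) →
    (if k = 0 then (0 : ℝ) else a (k - 1)) * a (k + 1) < a k ^ 2

/-- `σ_n(ℝ)`: the zero polynomial together with the polynomials of degree `n` or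
`n-1` with only real, simple zeros. -/
def sigmaR (n : ℕ) (P : Polynomial ℝ) : Prop :=
  P = 0 ∨ ((P.natDegree = n ∨ P.natDegree + 1 = n) ∧
    P.roots.card = P.natDegree ∧ ∀ x ∈ P.roots, P.roots.count x = 1)

/-- `P` and `Q` have strictly interspersed zeros: `P'Q - PQ'` never vanishes. -/
def StrictInt (P Q : Polynomial ℝ) : Prop :=
  ∀ t : ℝ, (Polynomial.derivative P * Q - P * Polynomial.derivative Q).eval t ≠ 0

end

theorem Rpoly_succ (n : ℕ) (q : ℝ) :
    Rpoly (n + 1) q = Rpoly n q * (1 + C (q ^ n) * X) := by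
  simp [Rpoly, Finset.prod_range_succ]

theorem Rpoly_succ' (n : ℕ) (q : ℝ) :
    Rpoly (n + 1) q = (1 + X) * (Rpoly n q).comp (C q * X) := by
  simp only [Rpoly, Finset.prod_range_succ', Polynomial.prod_comp, pow_succ]
  rw [mul_comm]
  congr 1
  · simp
  · refine Finset.prod_congr rfl fun j _ => ?_
    simp [mul_assoc]

theorem comp_C_mul_X_coeff' (F : ℝ[X]) (a : ℝ) (k : ℕ) :
    (F.comp (C a * X)).coeff k = F.coeff k * a ^ k :=
  Polynomial.comp_C_mul_X_coeff

theorem qBinom_zero_right (n : ℕ) (q : ℝ) : qBinom n 0 q = 1 := by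
  simp [qBinom, Rpoly, Polynomial.coeff_zero_eq_eval_zero, Polynomial.eval_prod]

theorem qBinom_succ_succ (n k : ℕ) (q : ℝ) :
    qBinom (n + 1) (k + 1) q = qBinom n (k + 1) q + q ^ n * qBinom n k q := by
  simp only [qBinom, Rpoly_succ, mul_add, mul_one, coeff_add]
  rw [show Rpoly n q * (C (q ^ n) * X) = C (q ^ n) * (Rpoly n q * X) by ring, coeff_C_mul,
    coeff_mul_X]

theorem qBinom_succ_succ' (n k : ℕ) (q : ℝ) :
    qBinom (n + 1) (k + 1) q = q ^ (k + 1) * qBinom n (k + 1) q + q ^ k * qBinom n k q := by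
  simp only [qBinom, Rpoly_succ', add_mul, one_mul, coeff_add, coeff_X_mul,
    comp_C_mul_X_coeff']
  ring

theorem Rpoly_natDegree_le (n : ℕ) (q : ℝ) : (Rpoly n q).natDegree ≤ n := by
  induction n with
  | zero => simp [Rpoly]
  | succ n ih =>
    rw [Rpoly_succ]
    refine Polynomial.natDegree_mul_le.trans (add_le_add ih ?_)
    compute_degree

theorem qBinom_eq_zero {n k : ℕ} (h : n < k) (q : ℝ) : qBinom n k q = 0 :=
  Polynomial.coeff_eq_zero_of_natDegree_lt ((Rpoly_natDegree_le n q).trans_lt h)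

theorem qBinom_pos {q : ℝ} (hq : 0 < q) : ∀ {n k : ℕ}, k ≤ n → 0 < qBinom n k q
  | n, 0, _ => by rw [qBinom_zero_right]; exact one_pos
  | 0, k + 1, h => by omega
  | n + 1, k + 1, h => by
    rw [qBinom_succ_succ]
    have h1 := qBinom_pos hq (n := n) (k := k) (by omega)
    have h2 : 0 ≤ qBinom n (k + 1) q := by
      rcases le_or_gt (k + 1) n with h' | h'
      · exact (qBinom_pos hq h').le
      · exact (qBinom_eq_zero h' q).ge
    positivity

/-- `(1 - q^{n+1-k}) C_k^{n+1} = (1 - q^{n+1}) C_k^n`, with denominators cleared. -/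
theorem qBinom_lower (n k : ℕ) (q : ℝ) :
    (q ^ k - q ^ (n + 1)) * qBinom (n + 1) k q = q ^ k * (1 - q ^ (n + 1)) * qBinom n k q := by
  cases k with
  | zero => simp [qBinom_zero_right]
  | succ k =>
    have h1 := qBinom_succ_succ n k q
    have h2 := qBinom_succ_succ' n k q
    have : (q ^ (k + 1) - q ^ (n + 1)) * qBinom (n + 1) (k + 1) q
        = q ^ (k + 1) * (qBinom n (k + 1) q + q ^ n * qBinom n k q)
          - q ^ (n + 1) * (q ^ (k + 1) * qBinom n (k + 1) q + q ^ k * qBinom n k q) := by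
      rw [← h1, ← h2]; ring
    rw [this]; ring

/-- `(1 - q^{k+1}) C_{k+1}^{n+1} = q^k (1 - q^{n+1}) C_k^n`. -/
theorem qBinom_lower_succ (n k : ℕ) (q : ℝ) :
    (1 - q ^ (k + 1)) * qBinom (n + 1) (k + 1) q = q ^ k * (1 - q ^ (n + 1)) * qBinom n k q := by
  have h1 := qBinom_succ_succ n k q
  have h2 := qBinom_succ_succ' n k q
  have : (1 - q ^ (k + 1)) * qBinom (n + 1) (k + 1) q
      = (q ^ (k + 1) * qBinom n (k + 1) q + q ^ k * qBinom n k q)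
        - q ^ (k + 1) * (qBinom n (k + 1) q + q ^ n * qBinom n k q) := by
    rw [← h1, ← h2]; ring
  rw [this]; ring

theorem qBinom_one (n k : ℕ) : qBinom n k 1 = (n.choose k : ℝ) := by
  have : Rpoly n 1 = (1 + X) ^ n := by simp [Rpoly]
  rw [qBinom, this, Polynomial.coeff_one_add_X_pow]

theorem coeff_qHadamard (n : ℕ) (q : ℝ) (F G : ℝ[X]) (k : ℕ) :
    (qHadamard n q F G).coeff k = F.coeff k * G.coeff k / qBinom n k q := by
  simp only [qHadamard, finsetSum_coeff, coeff_C_mul_X_pow]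
  rw [Finset.sum_ite_eq]
  split_ifs with h
  · rfl
  · rw [qBinom_eq_zero (by simpa using h), div_zero]

theorem qHadamard_comm (n : ℕ) (q : ℝ) (F G : ℝ[X]) :
    qHadamard n q F G = qHadamard n q G F := by
  ext k; simp only [coeff_qHadamard, mul_comm]

/-- The weighted Hadamard product as a bilinear map. -/
noncomputable def convL (n : ℕ) (q : ℝ) : ℝ[X] →ₗ[ℝ] ℝ[X] →ₗ[ℝ] ℝ[X] :=
  LinearMap.mk₂ ℝ (qHadamard n q)
    (fun f g h => by ext k; simp only [coeff_qHadamard, coeff_add]; ring)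
    (fun c f g => by ext k; simp only [coeff_qHadamard, coeff_smul, smul_eq_mul]; ring)
    (fun f g h => by ext k; simp only [coeff_qHadamard, coeff_add]; ring)
    (fun c f g => by ext k; simp only [coeff_qHadamard, coeff_smul, smul_eq_mul]; ring)

theorem convL_apply (n : ℕ) (q : ℝ) (F G : ℝ[X]) :
    convL n q F G = qHadamard n q F G := rfl

theorem convL_comm (n : ℕ) (q : ℝ) (F G : ℝ[X]) : convL n q F G = convL n q G F :=
  qHadamard_comm n q F G

theorem coeff_convL (n : ℕ) (q : ℝ) (F G : ℝ[X]) (k : ℕ) :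
    (convL n q F G).coeff k = F.coeff k * G.coeff k / qBinom n k q :=
  coeff_qHadamard n q F G k

/-- The product of the linear forms `s i * X + t i` over `i ∈ S`. -/
noncomputable def linProd (s t : ℕ → ℝ) (S : Finset ℕ) : ℝ[X] := ∏ i ∈ S, (C (s i) * X + C (t i))

theorem linProd_natDegree_le (s t : ℕ → ℝ) (S : Finset ℕ) :
    (linProd s t S).natDegree ≤ S.card := by
  refine (Polynomial.natDegree_prod_le _ _).trans ?_
  rw [Finset.card_eq_sum_ones]
  exact Finset.sum_le_sum fun i _ => natDegree_linear_le

theorem linProd_erase (s t : ℕ → ℝ) {S : Finset ℕ} {i : ℕ} (hi : i ∈ S) :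
    linProd s t S = s i • (X * linProd s t (S.erase i)) + t i • linProd s t (S.erase i) := by
  rw [linProd, ← Finset.mul_prod_erase S _ hi, linProd]
  simp only [smul_eq_C_mul]; ring

theorem linProd_insert (s t : ℕ → ℝ) {S : Finset ℕ} {i : ℕ} (hi : i ∉ S) :
    linProd s t (insert i S) = (C (s i) * X + C (t i)) * linProd s t S := by
  rw [linProd, Finset.prod_insert hi, linProd]

/-- Nondegenerate (normalised) linear forms whose zeros are logarithmically `q`-separated. -/
def SepFamily (q : ℝ) (s t : ℕ → ℝ) (S : Finset ℕ) : Prop :=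
  (∀ i ∈ S, t i = 1 ∨ (t i = 0 ∧ s i = 1)) ∧
  ∀ i ∈ S, ∀ j ∈ S, i ≠ j → t i = 1 → t j = 1 → 0 < s i * s j →
    |s i| ≤ q * |s j| ∨ |s j| ≤ q * |s i|

theorem SepFamily.mono {q : ℝ} {s t : ℕ → ℝ} {S U : Finset ℕ} (h : SepFamily q s t S)
    (hU : U ⊆ S) : SepFamily q s t U :=
  ⟨fun i hi => h.1 i (hU hi), fun i hi j hj => h.2 i (hU hi) j (hU hj)⟩

/-- Weights `β` and `b` expressing the `q`-difference operators of a product of linear forms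
through the products with one form omitted. -/
def IsRep (q : ℝ) (s t : ℕ → ℝ) (S : Finset ℕ) (β : ℕ → ℝ) (b : ℝ) : Prop :=
  (∀ i ∈ S, 0 ≤ β i) ∧ 0 < b ∧ ∀ H : ℝ[X], H.natDegree < S.card →
    convL S.card q (linProd s t S) H =
      convL (S.card - 1) q (∑ i ∈ S, (β i * t i) • linProd s t (S.erase i)) H ∧
    convL S.card q (linProd s t S) (X * H) =
      b • (X * convL (S.card - 1) q (∑ i ∈ S, (β i * s i) • linProd s t (S.erase i)) H)

theorem eval_linProd_erase_eq_zero {s t : ℕ → ℝ} {S : Finset ℕ} (ht : ∀ i ∈ S, t i = 1)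
    (hs : ∀ i ∈ S, s i ≠ 0) {i j : ℕ} (hi : i ∈ S) (hij : i ≠ j) :
    (linProd s t (S.erase j)).eval (-(s i)⁻¹) = 0 := by
  rw [linProd, eval_prod]
  refine Finset.prod_eq_zero (Finset.mem_erase.2 ⟨hij, hi⟩) ?_
  simp [ht i hi, hs i hi]

theorem eval_linProd_erase_ne_zero {s t : ℕ → ℝ} {S : Finset ℕ} (ht : ∀ i ∈ S, t i = 1)
    (hs : ∀ i ∈ S, s i ≠ 0) (hinj : Set.InjOn s S) {i : ℕ} (hi : i ∈ S) :
    (linProd s t (S.erase i)).eval (-(s i)⁻¹) ≠ 0 := by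
  rw [linProd, eval_prod, Finset.prod_ne_zero_iff]
  intro j hj h
  obtain ⟨hji, hj⟩ := Finset.mem_erase.1 hj
  have h0 := hs i hi
  rw [eval_add, eval_mul, eval_C, eval_X, eval_C, ht j hj] at h
  field_simp at h
  exact hji (hinj hj hi (by linarith))

theorem lagrange_linProd {s t : ℕ → ℝ} {S : Finset ℕ} (ht : ∀ i ∈ S, t i = 1)
    (hs : ∀ i ∈ S, s i ≠ 0) (hinj : Set.InjOn s S) {P : ℝ[X]} (hP : P.degree < S.card) :
    P = ∑ i ∈ S, (P.eval (-(s i)⁻¹) / (linProd s t (S.erase i)).eval (-(s i)⁻¹)) •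
      linProd s t (S.erase i) := by
  refine Polynomial.eq_of_degrees_lt_of_eval_index_eq (v := fun i => -(s i)⁻¹) S ?_ hP ?_ ?_
  · intro i hi j hj h
    exact hinj hi hj (by simpa using h)
  · refine (Polynomial.degree_sum_le _ _).trans_lt ?_
    rw [Finset.sup_lt_iff (by exact WithBot.bot_lt_coe _)]
    intro i hi
    refine (degree_smul_le _ _).trans_lt (degree_le_natDegree.trans_lt ?_)
    have h1 := linProd_natDegree_le s t (S.erase i)
    rw [Finset.card_erase_of_mem hi] at h1
    have h2 := Finset.card_pos.2 ⟨i, hi⟩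
    exact_mod_cast (by omega : (linProd s t (S.erase i)).natDegree < S.card)
  · intro i hi
    rw [eval_finsetSum, Finset.sum_eq_single i]
    · rw [eval_smul, smul_eq_mul, div_mul_cancel₀ _ (eval_linProd_erase_ne_zero ht hs hinj hi)]
    · intro j _ hji
      rw [eval_smul, eval_linProd_erase_eq_zero ht hs hi hji.symm, smul_zero]
    · exact fun h => absurd hi h

/-- Unnormalised version of `IsRep` for `q ≠ 1`, as polynomial identities. -/
def IsPolyRep (q : ℝ) (s t : ℕ → ℝ) (S : Finset ℕ) (β : ℕ → ℝ) : Prop :=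
  (q⁻¹ ^ S.card) • linProd s t S - (linProd s t S).comp (C q⁻¹ * X)
      = ∑ i ∈ S, (β i * t i) • linProd s t (S.erase i) ∧
  (linProd s t S).comp (C q⁻¹ * X) - linProd s t S
      = X * ∑ i ∈ S, (β i * s i) • linProd s t (S.erase i)

theorem isPolyRep_core {q : ℝ} {s t : ℕ → ℝ} {S : Finset ℕ}
    (ht : ∀ i ∈ S, t i = 1) (hs : ∀ i ∈ S, s i ≠ 0) (hinj : Set.InjOn s S) :
    IsPolyRep q s t S (fun i => (q⁻¹ - 1) * ∏ j ∈ S.erase i,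
      ((s j * (-(s i)⁻¹ * q⁻¹) + t j) / (s j * (-(s i)⁻¹) + t j))) := by
  set β : ℕ → ℝ := fun i => (q⁻¹ - 1) * ∏ j ∈ S.erase i,
      ((s j * (-(s i)⁻¹ * q⁻¹) + t j) / (s j * (-(s i)⁻¹) + t j)) with hβ
  have h1 : (q⁻¹ ^ S.card) • linProd s t S - (linProd s t S).comp (C q⁻¹ * X)
      = ∑ i ∈ S, (β i * t i) • linProd s t (S.erase i) := by
    rcases S.eq_empty_or_nonempty with rfl | hne
    · simp [linProd]
    set F := linProd s t S with hF
    have hdeg : ((q⁻¹ ^ S.card) • F - F.comp (C q⁻¹ * X)).degree < S.card := by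
      rw [degree_lt_iff_coeff_zero]
      intro k hk
      rw [coeff_sub, coeff_smul, comp_C_mul_X_coeff', smul_eq_mul]
      rcases hk.eq_or_lt with rfl | hk
      · ring
      · rw [coeff_eq_zero_of_natDegree_lt ((linProd_natDegree_le s t S).trans_lt hk)]; simp
    refine (lagrange_linProd ht hs hinj hdeg).trans ?_
    refine Finset.sum_congr rfl fun i hi => ?_
    congr 1
    have hFi : F = (C (s i) * X + C (t i)) * linProd s t (S.erase i) := by
      rw [hF, linProd_erase s t hi]; simp only [smul_eq_C_mul]; ring
    rw [div_eq_iff (eval_linProd_erase_ne_zero ht hs hinj hi), hβ]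
    simp only []
    rw [Finset.prod_div_distrib, ht i hi, mul_one]
    have e1 : ∏ j ∈ S.erase i, (s j * (-(s i)⁻¹) + t j)
        = (linProd s t (S.erase i)).eval (-(s i)⁻¹) := by simp [linProd, eval_prod]
    have e2 : ∏ j ∈ S.erase i, (s j * (-(s i)⁻¹ * q⁻¹) + t j)
        = (linProd s t (S.erase i)).eval (-(s i)⁻¹ * q⁻¹) := by simp [linProd, eval_prod]
    rw [e1, e2, mul_assoc, div_mul_cancel₀ _ (eval_linProd_erase_ne_zero ht hs hinj hi)]
    have h0 := hs i hi
    rw [eval_sub, eval_smul, eval_comp, hFi]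
    simp only [eval_mul, eval_add, eval_C, eval_X, ht i hi, smul_eq_mul]
    rw [mul_comm q⁻¹ (-(s i)⁻¹)]
    have : s i * -(s i)⁻¹ = -1 := by field_simp
    rw [← mul_assoc (s i), this]; ring
  refine ⟨h1, ?_⟩
  have h2 : (∑ i ∈ S, (β i * t i) • linProd s t (S.erase i))
      + X * ∑ i ∈ S, (β i * s i) • linProd s t (S.erase i) = (∑ i ∈ S, β i) • linProd s t S := by
    rw [Finset.sum_smul, Finset.mul_sum, ← Finset.sum_add_distrib]
    refine Finset.sum_congr rfl fun i hi => ?_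
    rw [linProd_erase s t hi]; simp only [smul_eq_C_mul, C_mul]; ring
  have h0 : ∀ U ⊆ S, (linProd s t U).eval 0 = 1 := fun U hU => by
    rw [linProd, eval_prod]
    exact Finset.prod_eq_one fun i hi => by simp [ht i (hU hi)]
  have h3 : ∑ i ∈ S, β i = q⁻¹ ^ S.card - 1 := by
    have := congrArg (Polynomial.eval 0) h1
    rw [eval_sub, eval_smul, eval_comp, eval_finsetSum] at this
    simp only [eval_mul, eval_C, eval_X, mul_zero, h0 S subset_rfl, smul_eq_mul, mul_one] at this
    rw [this]
    refine Finset.sum_congr rfl fun i hi => ?_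
    rw [eval_smul, h0 _ (Finset.erase_subset _ _), ht i hi]; simp
  rw [h3, ← h1, sub_smul, one_smul] at h2
  linear_combination -h2

theorem isPolyRep_insert_zero {q : ℝ} {s t : ℕ → ℝ} {S : Finset ℕ} {β : ℕ → ℝ} {o : ℕ}
    (ho : o ∉ S) (hs : s o = 1) (ht : t o = 0) (h : IsPolyRep q s t S β) :
    IsPolyRep q s t (insert o S) (fun i => if i = o then q⁻¹ - 1 else q⁻¹ * β i) := by
  have hX : linProd s t (insert o S) = X * linProd s t S := by
    rw [linProd_insert s t ho, hs, ht]; simp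
  have key : ∀ u : ℕ → ℝ,
      ∑ i ∈ S, ((if i = o then q⁻¹ - 1 else q⁻¹ * β i) * u i) • linProd s t ((insert o S).erase i)
        = C q⁻¹ * (X * ∑ i ∈ S, (β i * u i) • linProd s t (S.erase i)) := fun u => by
    rw [Finset.mul_sum, Finset.mul_sum]
    refine Finset.sum_congr rfl fun i hi => ?_
    have hio : i ≠ o := fun h => ho (h ▸ hi)
    rw [if_neg hio, Finset.erase_insert_of_ne hio.symm, linProd_insert s t
      (fun h => ho (Finset.mem_of_mem_erase h)), hs, ht]
    simp only [smul_eq_C_mul, C_mul, C_0, C_1]; ring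
  obtain ⟨h1, h2⟩ := h
  constructor
  · rw [Finset.sum_insert ho, key t, ← h1, hX, ht, Finset.card_insert_of_notMem ho]
    simp only [smul_eq_C_mul, C_mul, C_0, mul_comp, X_comp, mul_zero, pow_succ]; ring
  · rw [Finset.sum_insert ho, key s, ← h2, hX, hs, Finset.erase_insert ho]
    simp only [smul_eq_C_mul, C_1, mul_comp, X_comp, if_true, mul_one, C_sub]; ring

theorem isPolyRep_insert_inf {q : ℝ} {s t : ℕ → ℝ} {S : Finset ℕ} {β : ℕ → ℝ} {o : ℕ}
    (ho : o ∉ S) (hs : s o = 0) (ht : t o = 1) (h : IsPolyRep q s t S β) :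
    IsPolyRep q s t (insert o S)
      (fun i => if i = o then q⁻¹ ^ (S.card + 1) - q⁻¹ ^ S.card else β i) := by
  have hX : linProd s t (insert o S) = linProd s t S := by
    rw [linProd_insert s t ho, hs, ht]; simp
  have key : ∀ u : ℕ → ℝ,
      ∑ i ∈ S, ((if i = o then q⁻¹ ^ (S.card + 1) - q⁻¹ ^ S.card else β i) * u i) •
          linProd s t ((insert o S).erase i)
        = ∑ i ∈ S, (β i * u i) • linProd s t (S.erase i) := fun u => by
    refine Finset.sum_congr rfl fun i hi => ?_
    have hio : i ≠ o := fun h => ho (h ▸ hi)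
    rw [if_neg hio, Finset.erase_insert_of_ne hio.symm, linProd_insert s t
      (fun h => ho (Finset.mem_of_mem_erase h)), hs, ht]
    simp
  obtain ⟨h1, h2⟩ := h
  constructor
  · rw [Finset.sum_insert ho, key t, ← h1, hX, ht, Finset.card_insert_of_notMem ho,
      Finset.erase_insert ho]
    simp only [smul_eq_C_mul, if_true, mul_one, C_sub]; ring
  · rw [Finset.sum_insert ho, key s, hX, hs, h2]
    simp

theorem core_factor {q a b : ℝ} (hq : 0 < q) (hq1 : q ≤ 1) (ha : a ≠ 0)
    (h : 0 < a * b → |a| ≤ q * |b| ∨ |b| ≤ q * |a|) :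
    0 ≤ (b * (-a⁻¹ * q⁻¹) + 1) / (b * (-a⁻¹) + 1) := by
  have e1 : b * (-a⁻¹ * q⁻¹) + 1 = 1 - b / a / q := by field_simp; ring
  have e2 : b * (-a⁻¹) + 1 = 1 - b / a := by field_simp; ring
  rw [e1, e2]
  rcases le_or_gt (b / a) 0 with hr | hr
  · have := div_nonpos_of_nonpos_of_nonneg hr hq.le
    exact div_nonneg (by linarith) (by linarith)
  · have hab : 0 < a * b := by
      have := mul_pos hr (sq_pos_of_ne_zero ha)
      have e : b / a * a ^ 2 = a * b := by field_simp
      rwa [e] at this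
    have habs : |b| = b / a * |a| := by
      rw [← abs_of_pos hr, abs_div]; field_simp
    have ha' := abs_pos.2 ha
    rcases h hab with h | h
    · rw [habs] at h
      have h1 : 1 ≤ q * (b / a) := by
        by_contra hc
        push Not at hc
        nlinarith
      have h2 : 1 ≤ b / a := by nlinarith
      have h3 : b / a ≤ b / a / q := by
        rw [le_div_iff₀ hq]; nlinarith
      exact div_nonneg_of_nonpos (by linarith) (by linarith)
    · rw [habs] at h
      have h1 : b / a ≤ q := le_of_mul_le_mul_right h ha'
      have h2 : b / a / q ≤ 1 := by rwa [div_le_one hq]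
      exact div_nonneg (by linarith) (by linarith)

theorem core_factor_pos {q a b : ℝ} (hq : 0 < q) (hq1 : q ≤ 1) (ha : a ≠ 0)
    (h : |a| < q * |b| ∨ |b| < q * |a|) :
    0 < (b * (-a⁻¹ * q⁻¹) + 1) / (b * (-a⁻¹) + 1) := by
  refine lt_of_le_of_ne (core_factor hq hq1 ha fun _ => h.imp le_of_lt le_of_lt) (Ne.symm ?_)
  have e1 : b * (-a⁻¹ * q⁻¹) + 1 = (q * a - b) / (q * a) := by field_simp; ring
  have e2 : b * (-a⁻¹) + 1 = (a - b) / a := by field_simp; ring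
  have ha' := abs_pos.2 ha
  rw [e1, e2]
  refine div_ne_zero (div_ne_zero (fun h0 => ?_) (by positivity)) (div_ne_zero (fun h0 => ?_) ha)
  · have : b = q * a := by linarith
    rw [this, abs_mul, abs_of_pos hq] at h
    rcases h with h | h <;> nlinarith [mul_nonneg hq.le ha'.le]
  · have : b = a := by linarith
    rw [this] at h
    rcases h with h | h <;> nlinarith

theorem exists_isPolyRep {q : ℝ} (hq : 0 < q) (hq1 : q < 1) {s t : ℕ → ℝ} (S : Finset ℕ)
    (h : SepFamily q s t S) : ∃ β : ℕ → ℝ, (∀ i ∈ S, 0 ≤ β i) ∧ IsPolyRep q s t S β := by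
  have hqi : 1 < q⁻¹ := (one_lt_inv₀ hq).2 hq1
  induction S using Finset.strongInduction with
  | H S ih =>
  by_cases hz : ∃ o ∈ S, t o = 0
  · obtain ⟨o, hoS, hto⟩ := hz
    have hso : s o = 1 := (h.1 o hoS).elim (fun h1 => by simp [hto] at h1) (fun h1 => h1.2)
    obtain ⟨β, hβ, hr⟩ := ih _ (Finset.erase_ssubset hoS) (h.mono (Finset.erase_subset _ _))
    have := isPolyRep_insert_zero (Finset.notMem_erase o S) hso hto hr
    rw [Finset.insert_erase hoS] at this
    refine ⟨_, fun i hi => ?_, this⟩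
    split_ifs with hio
    · linarith
    · exact mul_nonneg (by positivity) (hβ i (Finset.mem_erase.2 ⟨hio, hi⟩))
  have ht : ∀ i ∈ S, t i = 1 := fun i hi =>
    (h.1 i hi).elim id (fun h1 => absurd ⟨i, hi, h1.1⟩ hz)
  by_cases hz' : ∃ o ∈ S, s o = 0
  · obtain ⟨o, hoS, hso⟩ := hz'
    obtain ⟨β, hβ, hr⟩ := ih _ (Finset.erase_ssubset hoS) (h.mono (Finset.erase_subset _ _))
    have := isPolyRep_insert_inf (Finset.notMem_erase o S) hso (ht o hoS) hr
    rw [Finset.insert_erase hoS] at this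
    refine ⟨_, fun i hi => ?_, this⟩
    split_ifs with hio
    · rw [sub_nonneg]
      exact pow_le_pow_right₀ hqi.le (Nat.le_succ _)
    · exact hβ i (Finset.mem_erase.2 ⟨hio, hi⟩)
  have hs : ∀ i ∈ S, s i ≠ 0 := fun i hi h0 => hz' ⟨i, hi, h0⟩
  have hinj : Set.InjOn s S := by
    intro i hi j hj hij
    by_contra hne
    have h0 := abs_pos.2 (hs i hi)
    have := h.2 i hi j hj hne (ht i hi) (ht j hj) (by rw [← hij]; exact mul_self_pos.2 (hs i hi))
    rw [← hij, or_self] at this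
    nlinarith
  refine ⟨_, fun i hi => ?_, isPolyRep_core ht hs hinj⟩
  refine mul_nonneg (by linarith) (Finset.prod_nonneg fun j hj => ?_)
  obtain ⟨hji, hj⟩ := Finset.mem_erase.1 hj
  rw [ht j hj]
  exact core_factor hq hq1.le (hs i hi) (h.2 i hi j hj hji.symm (ht i hi) (ht j hj))

theorem IsPolyRep.isRep {q : ℝ} (hq : 0 < q) (hq1 : q < 1) {s t : ℕ → ℝ} {S : Finset ℕ}
    (hS : S.Nonempty) {β : ℕ → ℝ} (hβ : ∀ i ∈ S, 0 ≤ β i) (h : IsPolyRep q s t S β) :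
    ∃ b, IsRep q s t S (fun i => (q⁻¹ ^ S.card - 1)⁻¹ * β i) b := by
  obtain ⟨n, hn⟩ : ∃ n, S.card = n + 1 := ⟨S.card - 1, by have := hS.card_pos; omega⟩
  have hqn : q ^ (n + 1) < 1 := pow_lt_one₀ hq.le hq1 (by omega)
  have hqn0 : 0 < q ^ (n + 1) := by positivity
  have hpos : 0 < q⁻¹ ^ (n + 1) - 1 := by
    rw [inv_pow, sub_pos]; exact (one_lt_inv₀ hqn0).2 hqn
  have hmul : ∀ u : ℕ → ℝ, ∑ i ∈ S, ((q⁻¹ ^ S.card - 1)⁻¹ * β i * u i) • linProd s t (S.erase i)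
      = (q⁻¹ ^ S.card - 1)⁻¹ • ∑ i ∈ S, (β i * u i) • linProd s t (S.erase i) := fun u => by
    rw [Finset.smul_sum]
    exact Finset.sum_congr rfl fun i _ => by rw [smul_smul, mul_assoc]
  have hC : ∀ k ≤ n, (0 : ℝ) < qBinom n k q := fun k hk => qBinom_pos hq hk
  refine ⟨q⁻¹ ^ n, fun i hi => mul_nonneg (by rw [hn]; exact (inv_pos.2 hpos).le) (hβ i hi),
    by positivity, fun H hH => ?_⟩
  simp only []
  rw [hmul, hmul, hn, Nat.add_sub_cancel]
  rw [hn] at hH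
  obtain ⟨h1, h2⟩ := h
  rw [hn] at h1
  have hH' : ∀ k, n < k → H.coeff k = 0 := fun k hk =>
    coeff_eq_zero_of_natDegree_lt (by omega)
  have hne : 1 - q ^ (n + 1) ≠ 0 := by linarith
  constructor
  · ext k
    rw [← h1]
    simp only [coeff_convL, coeff_smul, coeff_sub, comp_C_mul_X_coeff', smul_eq_mul]
    rcases lt_or_ge n k with hk | hk
    · rw [hH' k hk]; simp
    have hc := qBinom_lower n k q
    have hc1 := qBinom_pos hq (n := n + 1) (k := k) (by omega)
    have hc2 := hC k hk
    have e : (q⁻¹ ^ (n + 1) - 1)⁻¹ * (q⁻¹ ^ (n + 1) * (linProd s t S).coeff k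
        - (linProd s t S).coeff k * q⁻¹ ^ k)
        = (linProd s t S).coeff k * ((q ^ k - q ^ (n + 1)) / (q ^ k * (1 - q ^ (n + 1)))) := by
      have : q⁻¹ ^ (n + 1) - 1 = (1 - q ^ (n + 1)) / q ^ (n + 1) := by
        rw [inv_pow]; field_simp
      rw [this, inv_pow, inv_pow]
      field_simp
    have e' : (q ^ k - q ^ (n + 1)) / (q ^ k * (1 - q ^ (n + 1)))
        = qBinom n k q / qBinom (n + 1) k q := by
      rw [div_eq_div_iff (by positivity) hc1.ne', hc]; ring
    rw [e, e']
    field_simp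
  · ext k
    cases k with
    | zero => simp [coeff_convL]
    | succ k =>
    have h2k := congrArg (fun P => coeff P (k + 1)) h2
    simp only [coeff_sub, comp_C_mul_X_coeff', coeff_X_mul] at h2k
    simp only [coeff_convL, coeff_smul, coeff_X_mul, smul_eq_mul]
    rw [← h2k]
    rcases lt_or_ge n k with hk | hk
    · rw [hH' k hk]; simp
    have hc := qBinom_lower_succ n k q
    have hc1 := qBinom_pos hq (n := n + 1) (k := k + 1) (by omega)
    have hc2 := hC k hk
    have e : q⁻¹ ^ n * ((q⁻¹ ^ (n + 1) - 1)⁻¹ * ((linProd s t S).coeff (k + 1) * q⁻¹ ^ (k + 1)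
        - (linProd s t S).coeff (k + 1)))
        = (linProd s t S).coeff (k + 1) *
          ((1 - q ^ (k + 1)) / (q ^ k * (1 - q ^ (n + 1)))) := by
      have : q⁻¹ ^ (n + 1) - 1 = (1 - q ^ (n + 1)) / q ^ (n + 1) := by
        rw [inv_pow]; field_simp
      rw [this, inv_pow, inv_pow]
      field_simp
      ring
    have e' : (1 - q ^ (k + 1)) / (q ^ k * (1 - q ^ (n + 1)))
        = qBinom n k q / qBinom (n + 1) (k + 1) q := by
      rw [div_eq_div_iff (by positivity) hc1.ne', hc]; ring
    have e2 : ∀ a b c d h : ℝ, a * (b * c * h / d) = a * (b * c) * h / d := fun a b c d h => by ring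
    rw [e2, e, e']
    field_simp

theorem isRep_one (s t : ℕ → ℝ) {S : Finset ℕ} (hS : S.Nonempty) :
    IsRep 1 s t S (fun _ => (S.card : ℝ)⁻¹) 1 := by
  refine ⟨fun i _ => by positivity, one_pos, fun H hH => ?_⟩
  obtain ⟨n, hn⟩ : ∃ n, S.card = n + 1 := ⟨S.card - 1, by have := hS.card_pos; omega⟩
  have hmul : ∀ u : ℕ → ℝ, ∑ i ∈ S, ((S.card : ℝ)⁻¹ * u i) • linProd s t (S.erase i)
      = (S.card : ℝ)⁻¹ • ∑ i ∈ S, u i • linProd s t (S.erase i) := fun u => by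
    rw [Finset.smul_sum]
    exact Finset.sum_congr rfl fun i _ => by rw [smul_smul]
  have hB : ∑ i ∈ S, s i • linProd s t (S.erase i) = derivative (linProd s t S) := by
    rw [linProd, derivative_prod_finset]
    refine Finset.sum_congr rfl fun i _ => ?_
    rw [show derivative (C (s i) * X + C (t i)) = C (s i) by simp, smul_eq_C_mul, mul_comm]
    rfl
  have hA : ∑ i ∈ S, t i • linProd s t (S.erase i)
      = (S.card : ℝ) • linProd s t S - X * derivative (linProd s t S) := by
    rw [← hB, Finset.mul_sum, eq_sub_iff_add_eq, ← Finset.sum_add_distrib,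
      Finset.sum_congr rfl fun i hi => show _ = linProd s t S by
        rw [linProd_erase s t hi]; simp only [smul_eq_C_mul]; ring]
    simp [Finset.sum_const, smul_eq_C_mul]
  have hH' : ∀ k, n < k → H.coeff k = 0 := fun k hk =>
    coeff_eq_zero_of_natDegree_lt (by omega)
  have hC : ∀ k ≤ n, (0 : ℝ) < qBinom n k 1 := fun k hk => qBinom_pos one_pos hk
  rw [hmul, hmul, hA, hB, hn, Nat.add_sub_cancel]
  constructor
  · ext k
    simp only [coeff_convL, coeff_smul, coeff_sub, smul_eq_mul]
    rcases lt_or_ge n k with hk | hk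
    · rw [hH' k hk]; simp
    have hX : (X * derivative (linProd s t S)).coeff k = (linProd s t S).coeff k * k := by
      cases k with
      | zero => simp
      | succ k => rw [coeff_X_mul, coeff_derivative]; push_cast; ring
    have hc1 := qBinom_pos one_pos (n := n + 1) (k := k) (by omega)
    have hc2 := hC k hk
    have hc : ((n : ℝ) + 1 - k) * qBinom (n + 1) k 1 = (n + 1) * qBinom n k 1 := by
      rw [qBinom_one, qBinom_one]
      have := Nat.add_one_mul_choose_eq n k
      have h3 := Nat.choose_mul_succ_eq n k
      have h4 : ((n + 1 - k : ℕ) : ℝ) = (n : ℝ) + 1 - k := by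
        rw [Nat.cast_sub (by omega)]; push_cast; ring
      rw [← h4]
      exact_mod_cast (by rw [mul_comm, ← h3, mul_comm])
    rw [hX, div_eq_div_iff hc1.ne' hc2.ne']
    push_cast
    field_simp
    linear_combination -(linProd s t S).coeff k * H.coeff k * hc
  · ext k
    cases k with
    | zero => simp [coeff_convL]
    | succ k =>
    simp only [coeff_convL, coeff_smul, coeff_X_mul, smul_eq_mul, coeff_derivative]
    rcases lt_or_ge n k with hk | hk
    · rw [hH' k hk]; simp
    have hc1 := qBinom_pos one_pos (n := n + 1) (k := k + 1) (by omega)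
    have hc2 := hC k hk
    have hc : ((k : ℝ) + 1) * qBinom (n + 1) (k + 1) 1 = (n + 1) * qBinom n k 1 := by
      rw [qBinom_one, qBinom_one]
      have := Nat.add_one_mul_choose_eq n k
      rw [mul_comm ((k : ℝ) + 1)]
      exact_mod_cast this.symm
    rw [one_mul, div_eq_div_iff hc1.ne' hc2.ne']
    push_cast
    field_simp
    linear_combination -(linProd s t S).coeff (k + 1) * H.coeff k * hc

theorem exists_isRep {q : ℝ} (hq : 0 < q) (hq1 : q ≤ 1) {s t : ℕ → ℝ} {S : Finset ℕ}
    (hS : S.Nonempty) (h : SepFamily q s t S) : ∃ β b, IsRep q s t S β b := by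
  rcases hq1.eq_or_lt with rfl | hq1
  · exact ⟨_, _, isRep_one s t hS⟩
  · obtain ⟨β, hβ, hr⟩ := exists_isPolyRep hq hq1 S h
    exact ⟨_, hr.isRep hq hq1 hS hβ⟩

/-- For strictly separated zeros, all the weights are positive. -/
theorem exists_isRep_pos {q : ℝ} (hq : 0 < q) (hq1 : q ≤ 1) {s t : ℕ → ℝ} {S : Finset ℕ}
    (hS : S.Nonempty) (ht : ∀ i ∈ S, t i = 1) (hs : ∀ i ∈ S, s i ≠ 0) (hinj : Set.InjOn s S)
    (h : ∀ i ∈ S, ∀ j ∈ S, i ≠ j → |s i| < q * |s j| ∨ |s j| < q * |s i|) :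
    ∃ β b, IsRep q s t S β b ∧ ∀ i ∈ S, 0 < β i := by
  rcases hq1.eq_or_lt with rfl | hq1
  · exact ⟨_, _, isRep_one s t hS, fun i _ => by have := hS.card_pos; positivity⟩
  · have hqi : 1 < q⁻¹ := (one_lt_inv₀ hq).2 hq1
    have hpos : ∀ i ∈ S, 0 < (q⁻¹ - 1) * ∏ j ∈ S.erase i,
        ((s j * (-(s i)⁻¹ * q⁻¹) + t j) / (s j * (-(s i)⁻¹) + t j)) := fun i hi => by
      refine mul_pos (by linarith) (Finset.prod_pos fun j hj => ?_)
      obtain ⟨hji, hj⟩ := Finset.mem_erase.1 hj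
      rw [ht j hj]
      exact core_factor_pos hq hq1.le (hs i hi) (h i hi j hj hji.symm)
    obtain ⟨b, hb⟩ := (isPolyRep_core (q := q) ht hs hinj).isRep hq hq1 hS fun i hi => (hpos i hi).le
    refine ⟨_, b, hb, fun i hi => mul_pos (inv_pos.2 (sub_pos.2 ?_)) (hpos i hi)⟩
    exact one_lt_pow₀ hqi hS.card_pos.ne'

/-- The real part of the Hermitian product of the values at `z`. -/
noncomputable def reProd (z : ℂ) (f g : ℝ[X]) : ℝ :=
  (aeval z f * (starRingEnd ℂ) (aeval z g)).re

/-- An alternating bilinear form on real polynomials that behaves like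
`Im (f z * conj (g z)) / Im z`, or like its limit, the Wronskian, for real `z`. -/
structure IsWronskian (z : ℂ) (ω : ℝ[X] →ₗ[ℝ] ℝ[X] →ₗ[ℝ] ℝ) : Prop where
  antisymm : ∀ f g, ω f g = -ω g f
  mul_X : ∀ f g, ω f (X * g) = z.re * ω f g - reProd z f g
  im_mul : ∀ f g, z.im * ω f g = (aeval z f * (starRingEnd ℂ) (aeval z g)).im

theorem reProd_comm (z : ℂ) (f g : ℝ[X]) : reProd z f g = reProd z g f := by
  simp only [reProd, Complex.mul_re, Complex.conj_re, Complex.conj_im]; ring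

theorem reProd_add_left (z : ℂ) (f g h : ℝ[X]) :
    reProd z (f + g) h = reProd z f h + reProd z g h := by
  simp only [reProd, map_add, add_mul, Complex.add_re]

theorem reProd_smul_left (z : ℂ) (c : ℝ) (f h : ℝ[X]) :
    reProd z (c • f) h = c * reProd z f h := by
  simp [reProd, mul_assoc]

theorem reProd_add_right (z : ℂ) (f g h : ℝ[X]) :
    reProd z h (f + g) = reProd z h f + reProd z h g := by
  simp only [reProd_comm z h, reProd_add_left]

theorem reProd_smul_right (z : ℂ) (c : ℝ) (f h : ℝ[X]) :
    reProd z h (c • f) = c * reProd z h f := by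
  simp only [reProd_comm z h, reProd_smul_left]

theorem reProd_sum_left {ι : Type*} (z : ℂ) (S : Finset ι) (f : ι → ℝ[X]) (h : ℝ[X]) :
    reProd z (∑ i ∈ S, f i) h = ∑ i ∈ S, reProd z (f i) h := by
  simp only [reProd, map_sum, Finset.sum_mul, Complex.re_sum]

theorem reProd_sum_right {ι : Type*} (z : ℂ) (S : Finset ι) (f : ι → ℝ[X]) (h : ℝ[X]) :
    reProd z h (∑ i ∈ S, f i) = ∑ i ∈ S, reProd z h (f i) := by
  simp only [reProd_comm z h, reProd_sum_left]

theorem reProd_self (z : ℂ) (f : ℝ[X]) : reProd z f f = Complex.normSq (aeval z f) := by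
  rw [reProd, Complex.mul_conj, Complex.ofReal_re]

theorem reProd_self_nonneg (z : ℂ) (f : ℝ[X]) : 0 ≤ reProd z f f := by
  rw [reProd_self]; exact Complex.normSq_nonneg _

namespace IsWronskian

variable {z : ℂ} {ω : ℝ[X] →ₗ[ℝ] ℝ[X] →ₗ[ℝ] ℝ}

theorem self_eq_zero (hω : IsWronskian z ω) (f : ℝ[X]) : ω f f = 0 := by
  have := hω.antisymm f f
  linarith

theorem reProd_X_mul (hω : IsWronskian z ω) (f g : ℝ[X]) :
    reProd z (X * f) g = z.re * reProd z f g - z.im ^ 2 * ω f g := by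
  have := hω.im_mul f g
  rw [pow_two, mul_assoc, this]
  simp only [reProd, map_mul, aeval_X, mul_assoc, Complex.mul_re z]

theorem wronskian_pair (hω : IsWronskian z ω) (U V : ℝ[X]) (s t s' t' : ℝ) :
    ω (s' • U + t' • V) (s • U + t • V) = (s * t' - s' * t) * ω V U := by
  simp only [map_add, map_smul, LinearMap.add_apply, LinearMap.smul_apply, smul_eq_mul,
    hω.self_eq_zero, hω.antisymm U V]
  ring

theorem pair_identity (hω : IsWronskian z ω) (W V : ℝ[X]) (s t s' t' : ℝ) :
    -z.re * (s * t' - s' * t) * ω (s' • (X * W) + t' • V) (s • (X * W) + t • V)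
      - (t * s' + t' * s) * reProd z (s' • (X * W) + t' • V) (s • (X * W) + t • V)
    = (s * t' - s' * t) ^ 2 * (z.re ^ 2 + z.im ^ 2) * ω W V
      - (t * s * reProd z (s' • (X * W) + t' • V) (s' • (X * W) + t' • V)
        + t' * s' * reProd z (s • (X * W) + t • V) (s • (X * W) + t • V)) := by
  rw [hω.wronskian_pair]
  have h1 : reProd z (X * W) (X * W) = (z.re ^ 2 + z.im ^ 2) * reProd z W W := by
    rw [hω.reProd_X_mul, reProd_comm z W, hω.reProd_X_mul, hω.mul_X, hω.self_eq_zero]; ring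
  have h2 : reProd z V (X * W) = reProd z (X * W) V := reProd_comm _ _ _
  have h3 := hω.reProd_X_mul W V
  have h4 := hω.mul_X V W
  have h5 := hω.antisymm V W
  have h6 := reProd_comm z V W
  simp only [reProd_add_left, reProd_add_right, reProd_smul_left, reProd_smul_right]
  rw [h2, h4, h3, h5, h6]
  ring

theorem sum_sum (hω : IsWronskian z ω) (S : Finset ℕ) (β s t : ℕ → ℝ) (f : ℕ → ℝ[X]) :
    ω (∑ i ∈ S, (β i * s i) • f i) (∑ i ∈ S, (β i * t i) • f i)
      = 2⁻¹ * ∑ i ∈ S, ∑ j ∈ S, β i * β j * ((s i * t j - s j * t i) * ω (f i) (f j)) := by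
  have h1 : ω (∑ i ∈ S, (β i * s i) • f i) (∑ i ∈ S, (β i * t i) • f i)
      = ∑ i ∈ S, ∑ j ∈ S, β i * β j * (s i * t j * ω (f i) (f j)) := by
    simp only [map_sum, map_smul, LinearMap.sum_apply, LinearMap.smul_apply, smul_eq_mul,
      Finset.mul_sum]
    rw [Finset.sum_comm]
    exact Finset.sum_congr rfl fun i _ => Finset.sum_congr rfl fun j _ => by ring
  have h2 : ω (∑ i ∈ S, (β i * s i) • f i) (∑ i ∈ S, (β i * t i) • f i)
      = ∑ i ∈ S, ∑ j ∈ S, β i * β j * (-(s j * t i) * ω (f i) (f j)) := by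
    rw [h1, Finset.sum_comm]
    exact Finset.sum_congr rfl fun i _ => Finset.sum_congr rfl fun j _ => by
      rw [hω.antisymm (f j)]; ring
  have h3 : ∑ i ∈ S, ∑ j ∈ S, β i * β j * ((s i * t j - s j * t i) * ω (f i) (f j))
      = ∑ i ∈ S, ∑ j ∈ S, β i * β j * (s i * t j * ω (f i) (f j))
        + ∑ i ∈ S, ∑ j ∈ S, β i * β j * (-(s j * t i) * ω (f i) (f j)) := by
    simp only [← Finset.sum_add_distrib]
    exact Finset.sum_congr rfl fun i _ => Finset.sum_congr rfl fun j _ => by ring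
  rw [h3, ← h1, ← h2]
  ring

theorem reProd_sum_sum (S : Finset ℕ) (β s t : ℕ → ℝ) (f : ℕ → ℝ[X]) :
    reProd z (∑ i ∈ S, (β i * t i) • f i) (∑ i ∈ S, (β i * s i) • f i)
      = 2⁻¹ * ∑ i ∈ S, ∑ j ∈ S, β i * β j * ((t i * s j + t j * s i) * reProd z (f i) (f j)) := by
  have h1 : reProd z (∑ i ∈ S, (β i * t i) • f i) (∑ i ∈ S, (β i * s i) • f i)
      = ∑ i ∈ S, ∑ j ∈ S, β i * β j * (t i * s j * reProd z (f i) (f j)) := by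
    simp only [reProd_sum_left, reProd_sum_right, reProd_smul_left, reProd_smul_right,
      Finset.mul_sum]
    rw [Finset.sum_comm]
    exact Finset.sum_congr rfl fun i _ => Finset.sum_congr rfl fun j _ => by ring
  have h2 : reProd z (∑ i ∈ S, (β i * t i) • f i) (∑ i ∈ S, (β i * s i) • f i)
      = ∑ i ∈ S, ∑ j ∈ S, β i * β j * (t j * s i * reProd z (f i) (f j)) := by
    rw [h1, Finset.sum_comm]
    exact Finset.sum_congr rfl fun i _ => Finset.sum_congr rfl fun j _ => by
      rw [reProd_comm z (f j)]; ring
  have h3 : ∑ i ∈ S, ∑ j ∈ S, β i * β j * ((t i * s j + t j * s i) * reProd z (f i) (f j))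
      = ∑ i ∈ S, ∑ j ∈ S, β i * β j * (t i * s j * reProd z (f i) (f j))
        + ∑ i ∈ S, ∑ j ∈ S, β i * β j * (t j * s i * reProd z (f i) (f j)) := by
    simp only [← Finset.sum_add_distrib]
    exact Finset.sum_congr rfl fun i _ => Finset.sum_congr rfl fun j _ => by ring
  rw [h3, ← h1, ← h2]
  ring

theorem sum_term_eq (hω : IsWronskian z ω) {s t : ℕ → ℝ} {f : ℕ → ℝ[X]} {i j : ℕ} {U V : ℝ[X]}
    (hi : f i = s j • U + t j • V) (hj : f j = s i • U + t i • V) :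
    (s i * t j - s j * t i) * ω (f i) (f j) = (s i * t j - s j * t i) ^ 2 * ω V U := by
  rw [hi, hj, hω.wronskian_pair]; ring

theorem sum_nonpos (hω : IsWronskian z ω) {S : Finset ℕ} {β s t : ℕ → ℝ} {f : ℕ → ℝ[X]}
    (hβ : ∀ i ∈ S, 0 ≤ β i)
    (hf : ∀ i ∈ S, ∀ j ∈ S, i ≠ j → ∃ U V, f i = s j • U + t j • V ∧ f j = s i • U + t i • V ∧
      ω V U ≤ 0) :
    ω (∑ i ∈ S, (β i * s i) • f i) (∑ i ∈ S, (β i * t i) • f i) ≤ 0 := by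
  rw [hω.sum_sum]
  refine mul_nonpos_of_nonneg_of_nonpos (by norm_num)
    (Finset.sum_nonpos fun i hi => Finset.sum_nonpos fun j hj => ?_)
  refine mul_nonpos_of_nonneg_of_nonpos (mul_nonneg (hβ i hi) (hβ j hj)) ?_
  rcases eq_or_ne i j with rfl | hij
  · simp
  · obtain ⟨U, V, h1, h2, h3⟩ := hf i hi j hj hij
    rw [hω.sum_term_eq h1 h2]
    exact mul_nonpos_of_nonneg_of_nonpos (sq_nonneg _) h3

theorem sum_neg (hω : IsWronskian z ω) {S : Finset ℕ} {β s t : ℕ → ℝ} {f : ℕ → ℝ[X]}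
    (hβ : ∀ i ∈ S, 0 ≤ β i)
    (hf : ∀ i ∈ S, ∀ j ∈ S, i ≠ j → ∃ U V, f i = s j • U + t j • V ∧ f j = s i • U + t i • V ∧
      ω V U < 0)
    (hpair : ∃ i ∈ S, ∃ j ∈ S, 0 < β i ∧ 0 < β j ∧ s i * t j - s j * t i ≠ 0) :
    ω (∑ i ∈ S, (β i * s i) • f i) (∑ i ∈ S, (β i * t i) • f i) < 0 := by
  have hle : ∀ i ∈ S, ∀ j ∈ S,
      β i * β j * ((s i * t j - s j * t i) * ω (f i) (f j)) ≤ 0 := fun i hi j hj => by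
    refine mul_nonpos_of_nonneg_of_nonpos (mul_nonneg (hβ i hi) (hβ j hj)) ?_
    rcases eq_or_ne i j with rfl | hij
    · simp
    · obtain ⟨U, V, h1, h2, h3⟩ := hf i hi j hj hij
      rw [hω.sum_term_eq h1 h2]
      exact mul_nonpos_of_nonneg_of_nonpos (sq_nonneg _) h3.le
  rw [hω.sum_sum]
  obtain ⟨i, hi, j, hj, hβi, hβj, hD⟩ := hpair
  refine mul_neg_of_pos_of_neg (by norm_num) (Finset.sum_neg' (fun i hi => Finset.sum_nonpos
    (hle i hi)) ⟨i, hi, Finset.sum_neg' (hle i hi) ⟨j, hj, ?_⟩⟩)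
  have hij : i ≠ j := by rintro rfl; exact hD (sub_self _)
  obtain ⟨U, V, h1, h2, h3⟩ := hf i hi j hj hij
  rw [hω.sum_term_eq h1 h2]
  exact mul_neg_of_pos_of_neg (mul_pos hβi hβj) (mul_neg_of_pos_of_neg (by positivity) h3)

theorem sum_X_mul_sum_le (hω : IsWronskian z ω) {S : Finset ℕ} {β s t : ℕ → ℝ} {f : ℕ → ℝ[X]}
    (hβ : ∀ i ∈ S, 0 ≤ β i)
    (hf : ∀ i ∈ S, ∀ j ∈ S, i ≠ j → ∃ W V, f i = s j • (X * W) + t j • V ∧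
      f j = s i • (X * W) + t i • V ∧ ω W V ≤ 0) :
    ω (∑ i ∈ S, (β i * t i) • f i) (X * ∑ i ∈ S, (β i * s i) • f i)
      ≤ -((∑ i ∈ S, β i) * ∑ i ∈ S, β i * (s i * t i * reProd z (f i) (f i))) := by
  have hR : -((∑ i ∈ S, β i) * ∑ i ∈ S, β i * (s i * t i * reProd z (f i) (f i)))
      = 2⁻¹ * ∑ i ∈ S, ∑ j ∈ S, β i * β j *
        -(s i * t i * reProd z (f i) (f i) + s j * t j * reProd z (f j) (f j)) := by
    have h1 : (∑ i ∈ S, β i) * ∑ i ∈ S, β i * (s i * t i * reProd z (f i) (f i))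
        = ∑ i ∈ S, ∑ j ∈ S, β i * β j * (s j * t j * reProd z (f j) (f j)) := by
      rw [Finset.sum_mul_sum]
      exact Finset.sum_congr rfl fun i _ => Finset.sum_congr rfl fun j _ => by ring
    have h2 : (∑ i ∈ S, β i) * ∑ i ∈ S, β i * (s i * t i * reProd z (f i) (f i))
        = ∑ i ∈ S, ∑ j ∈ S, β i * β j * (s i * t i * reProd z (f i) (f i)) := by
      rw [h1, Finset.sum_comm]
      exact Finset.sum_congr rfl fun i _ => Finset.sum_congr rfl fun j _ => by ring
    have h3 : ∑ i ∈ S, ∑ j ∈ S, β i * β j *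
          -(s i * t i * reProd z (f i) (f i) + s j * t j * reProd z (f j) (f j))
        = -(∑ i ∈ S, ∑ j ∈ S, β i * β j * (s j * t j * reProd z (f j) (f j))
          + ∑ i ∈ S, ∑ j ∈ S, β i * β j * (s i * t i * reProd z (f i) (f i))) := by
      simp only [← Finset.sum_add_distrib, ← Finset.sum_neg_distrib]
      exact Finset.sum_congr rfl fun i _ => Finset.sum_congr rfl fun j _ => by ring
    rw [h3, ← h1, ← h2]; ring
  have hL : ω (∑ i ∈ S, (β i * t i) • f i) (X * ∑ i ∈ S, (β i * s i) • f i)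
      = 2⁻¹ * ∑ i ∈ S, ∑ j ∈ S, β i * β j * (-z.re * (s i * t j - s j * t i) * ω (f i) (f j)
        - (t i * s j + t j * s i) * reProd z (f i) (f j)) := by
    rw [hω.mul_X, hω.antisymm, hω.sum_sum, reProd_sum_sum]
    simp only [mul_sub, Finset.sum_sub_distrib, Finset.mul_sum, ← Finset.sum_neg_distrib]
    congr 1
    exact Finset.sum_congr rfl fun i _ => Finset.sum_congr rfl fun j _ => by ring
  rw [hL, hR]
  refine mul_le_mul_of_nonneg_left (Finset.sum_le_sum fun i hi => Finset.sum_le_sum fun j hj => ?_)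
    (by norm_num)
  refine mul_le_mul_of_nonneg_left ?_ (mul_nonneg (hβ i hi) (hβ j hj))
  rcases eq_or_ne i j with rfl | hij
  · exact le_of_eq (by ring)
  · obtain ⟨W, V, h1, h2, h3⟩ := hf i hi j hj hij
    have := hω.pair_identity W V (s i) (t i) (s j) (t j)
    rw [← h1, ← h2] at this
    rw [this]
    have h4 : (s i * t j - s j * t i) ^ 2 * (z.re ^ 2 + z.im ^ 2) * ω W V ≤ 0 :=
      mul_nonpos_of_nonneg_of_nonpos (by positivity) h3
    linarith

end IsWronskian

theorem exists_convL_X_mul (n : ℕ) (q : ℝ) (F G : ℝ[X]) :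
    ∃ W, convL n q F (X * G) = X * W :=
  X_dvd_iff.2 (by simp [coeff_convL])

theorem convL_sum_left (n : ℕ) (q : ℝ) (S : Finset ℕ) (c : ℕ → ℝ) (f : ℕ → ℝ[X]) (H : ℝ[X]) :
    convL n q (∑ i ∈ S, c i • f i) H = ∑ i ∈ S, c i • convL n q (f i) H := by
  simp only [map_sum, LinearMap.sum_apply, map_smul, LinearMap.smul_apply]

theorem convL_linProd_erase (n : ℕ) (q : ℝ) (s t : ℕ → ℝ) {S : Finset ℕ} {i : ℕ} (hi : i ∈ S)
    (H : ℝ[X]) : convL n q (linProd s t S) H = s i • convL n q (X * linProd s t (S.erase i)) H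
      + t i • convL n q (linProd s t (S.erase i)) H := by
  rw [linProd_erase s t hi]
  simp only [map_add, map_smul, LinearMap.add_apply, LinearMap.smul_apply]

theorem convL_erase_pair (n : ℕ) (q : ℝ) (s t : ℕ → ℝ) {S : Finset ℕ} {i j : ℕ} (hi : i ∈ S)
    (hj : j ∈ S) (hij : i ≠ j) (H : ℝ[X]) :
    convL n q (linProd s t (S.erase i)) H
      = s j • convL n q (X * linProd s t ((S.erase i).erase j)) H
        + t j • convL n q (linProd s t ((S.erase i).erase j)) H ∧
    convL n q (linProd s t (S.erase j)) H
      = s i • convL n q (X * linProd s t ((S.erase i).erase j)) H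
        + t i • convL n q (linProd s t ((S.erase i).erase j)) H := by
  refine ⟨convL_linProd_erase n q s t (Finset.mem_erase.2 ⟨hij.symm, hj⟩) H, ?_⟩
  rw [Finset.erase_right_comm]
  exact convL_linProd_erase n q s t (Finset.mem_erase.2 ⟨hij, hi⟩) H

theorem card_erase_erase {S : Finset ℕ} {i j : ℕ} (hi : i ∈ S) (hj : j ∈ S) (hij : i ≠ j) :
    ((S.erase i).erase j).card = S.card - 2 := by
  rw [Finset.card_erase_of_mem (Finset.mem_erase.2 ⟨hij.symm, hj⟩), Finset.card_erase_of_mem hi]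
  omega

theorem SepFamily.erase_erase {q : ℝ} {s t : ℕ → ℝ} {S : Finset ℕ} (h : SepFamily q s t S)
    (i j : ℕ) : SepFamily q s t ((S.erase i).erase j) :=
  h.mono ((Finset.erase_subset _ _).trans (Finset.erase_subset _ _))

namespace IsRep

variable {q b : ℝ} {s t β : ℕ → ℝ} {S : Finset ℕ}

theorem convL_eq (h : IsRep q s t S β b) {H : ℝ[X]} (hH : H.natDegree < S.card) :
    convL S.card q (linProd s t S) H
      = ∑ i ∈ S, (β i * t i) • convL (S.card - 1) q (linProd s t (S.erase i)) H := by
  rw [(h.2.2 H hH).1, convL_sum_left]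

theorem convL_X_mul_eq (h : IsRep q s t S β b) {H : ℝ[X]} (hH : H.natDegree < S.card) :
    convL S.card q (linProd s t S) (X * H)
      = X * b • ∑ i ∈ S, (β i * s i) • convL (S.card - 1) q (linProd s t (S.erase i)) H := by
  rw [(h.2.2 H hH).2, convL_sum_left, mul_smul_comm]

theorem eq_of_convL_X_mul (h : IsRep q s t S β b) {H W : ℝ[X]} (hH : H.natDegree < S.card)
    (hW : convL S.card q (linProd s t S) (X * H) = X * W) :
    W = b • ∑ i ∈ S, (β i * s i) • convL (S.card - 1) q (linProd s t (S.erase i)) H := by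
  rw [h.convL_X_mul_eq hH] at hW
  exact (mul_left_cancel₀ X_ne_zero hW).symm

variable {z : ℂ} {ω : ℝ[X] →ₗ[ℝ] ℝ[X] →ₗ[ℝ] ℝ}

theorem wronskian_nonpos (h : IsRep q s t S β b) (hω : IsWronskian z ω) {H W : ℝ[X]}
    (hH : H.natDegree < S.card) (hW : convL S.card q (linProd s t S) (X * H) = X * W)
    (hp : ∀ i ∈ S, ∀ j ∈ S, i ≠ j →
      ω (convL (S.card - 1) q H (linProd s t ((S.erase i).erase j)))
        (convL (S.card - 1) q H (X * linProd s t ((S.erase i).erase j))) ≤ 0) :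
    ω W (convL S.card q (linProd s t S) H) ≤ 0 := by
  rw [h.eq_of_convL_X_mul hH hW, h.convL_eq hH, map_smul, LinearMap.smul_apply, smul_eq_mul]
  refine mul_nonpos_of_nonneg_of_nonpos h.2.1.le (hω.sum_nonpos h.1 fun i hi j hj hij => ?_)
  have := hp i hi j hj hij
  rw [convL_comm, convL_comm _ _ H] at this
  exact ⟨_, _, (convL_erase_pair _ q s t hi hj hij H).1, (convL_erase_pair _ q s t hi hj hij H).2,
    this⟩

theorem wronskian_neg (h : IsRep q s t S β b) (hω : IsWronskian z ω) {H W : ℝ[X]}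
    (hH : H.natDegree < S.card) (hW : convL S.card q (linProd s t S) (X * H) = X * W)
    (hp : ∀ i ∈ S, ∀ j ∈ S, i ≠ j →
      ω (convL (S.card - 1) q H (linProd s t ((S.erase i).erase j)))
        (convL (S.card - 1) q H (X * linProd s t ((S.erase i).erase j))) < 0)
    (hpair : ∃ i ∈ S, ∃ j ∈ S, 0 < β i ∧ 0 < β j ∧ s i * t j - s j * t i ≠ 0) :
    ω W (convL S.card q (linProd s t S) H) < 0 := by
  rw [h.eq_of_convL_X_mul hH hW, h.convL_eq hH, map_smul, LinearMap.smul_apply, smul_eq_mul]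
  refine mul_neg_of_pos_of_neg h.2.1 (hω.sum_neg h.1 (fun i hi j hj hij => ?_) hpair)
  have := hp i hi j hj hij
  rw [convL_comm, convL_comm _ _ H] at this
  exact ⟨_, _, (convL_erase_pair _ q s t hi hj hij H).1, (convL_erase_pair _ q s t hi hj hij H).2,
    this⟩

theorem wronskian_X_mul_le (h : IsRep q s t S β b) (hω : IsWronskian z ω) {H : ℝ[X]}
    (hH : H.natDegree < S.card)
    (hp : ∀ i ∈ S, ∀ j ∈ S, i ≠ j → ∀ W,
      convL (S.card - 1) q H (X * linProd s t ((S.erase i).erase j)) = X * W →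
      ω W (convL (S.card - 1) q H (linProd s t ((S.erase i).erase j))) ≤ 0) :
    ω (convL S.card q (linProd s t S) H) (convL S.card q (linProd s t S) (X * H))
      ≤ b * -((∑ i ∈ S, β i) * ∑ i ∈ S, β i * (s i * t i *
        reProd z (convL (S.card - 1) q (linProd s t (S.erase i)) H)
          (convL (S.card - 1) q (linProd s t (S.erase i)) H))) := by
  rw [h.convL_eq hH, h.convL_X_mul_eq hH, mul_smul_comm, map_smul, smul_eq_mul]
  refine mul_le_mul_of_nonneg_left (hω.sum_X_mul_sum_le h.1 fun i hi j hj hij => ?_) h.2.1.le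
  obtain ⟨W, hW⟩ := exists_convL_X_mul (S.card - 1) q H (linProd s t ((S.erase i).erase j))
  have := hp i hi j hj hij W hW
  rw [convL_comm] at this
  obtain ⟨h1, h2⟩ := convL_erase_pair (S.card - 1) q s t hi hj hij H
  rw [convL_comm _ _ (X * _), hW] at h1 h2
  exact ⟨W, _, h1, h2, this⟩

end IsRep

/-- The two interlacing properties of products of a separated family with a separated family
having only nonpositive zeros. -/
theorem wronskian_convL_nonpos {z : ℂ} {ω : ℝ[X] →ₗ[ℝ] ℝ[X] →ₗ[ℝ] ℝ} (hω : IsWronskian z ω)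
    {q : ℝ} (hq : 0 < q) (hq1 : q ≤ 1) (n : ℕ) {s t s' t' : ℕ → ℝ} {S U : Finset ℕ}
    (hS : SepFamily q s t S) (hU : SepFamily q s' t' U) :
    (S.card = n + 1 → U.card = n → (∀ i ∈ U, 0 ≤ s' i * t' i) → ∀ W,
      convL (n + 1) q (linProd s t S) (X * linProd s' t' U) = X * W →
      ω W (convL (n + 1) q (linProd s t S) (linProd s' t' U)) ≤ 0) ∧
    (U.card = n + 1 → S.card = n → (∀ i ∈ U, 0 ≤ s' i * t' i) →
      ω (convL (n + 1) q (linProd s' t' U) (linProd s t S))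
        (convL (n + 1) q (linProd s' t' U) (X * linProd s t S)) ≤ 0) := by
  induction n generalizing s t s' t' S U with
  | zero =>
    refine ⟨fun hSc hUc hpos W hW => ?_, fun hUc hSc hpos => ?_⟩
    · obtain ⟨β, b, h⟩ := exists_isRep hq hq1 (Finset.card_pos.1 (by omega)) hS
      have hd := linProd_natDegree_le s' t' U
      rw [← hSc] at hW ⊢
      refine h.wronskian_nonpos hω (by omega) hW fun i hi j hj hij => ?_
      exact absurd (Finset.card_le_one.1 (by omega) i hi j hj) hij
    · obtain ⟨β, b, h⟩ := exists_isRep hq hq1 (Finset.card_pos.1 (by omega)) hU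
      have hd := linProd_natDegree_le s t S
      rw [← hUc]
      refine (h.wronskian_X_mul_le hω (by omega) fun i hi j hj hij => ?_).trans ?_
      · exact absurd (Finset.card_le_one.1 (by omega) i hi j hj) hij
      · refine mul_nonpos_of_nonneg_of_nonpos h.2.1.le (neg_nonpos.2 (mul_nonneg
          (Finset.sum_nonneg h.1) (Finset.sum_nonneg fun i hi => mul_nonneg (h.1 i hi)
            (mul_nonneg (hpos i hi) (reProd_self_nonneg _ _)))))
  | succ n ih =>
    refine ⟨fun hSc hUc hpos W hW => ?_, fun hUc hSc hpos => ?_⟩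
    · obtain ⟨β, b, h⟩ := exists_isRep hq hq1 (Finset.card_pos.1 (by omega)) hS
      have hd := linProd_natDegree_le s' t' U
      rw [← hSc] at hW ⊢
      refine h.wronskian_nonpos hω (by omega) hW fun i hi j hj hij => ?_
      have hc := card_erase_erase hi hj hij
      rw [show S.card - 1 = n + 1 by omega]
      exact (ih (hS.erase_erase i j) hU).2 hUc (by omega) hpos
    · obtain ⟨β, b, h⟩ := exists_isRep hq hq1 (Finset.card_pos.1 (by omega)) hU
      have hd := linProd_natDegree_le s t S
      rw [← hUc]
      refine (h.wronskian_X_mul_le hω (by omega) fun i hi j hj hij W hW => ?_).trans ?_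
      · have hc := card_erase_erase hi hj hij
        rw [show U.card - 1 = n + 1 by omega] at hW ⊢
        exact (ih hS (hU.erase_erase i j)).1 hSc (by omega)
          (fun k hk => hpos k (Finset.mem_of_mem_erase (Finset.mem_of_mem_erase hk))) W hW
      · refine mul_nonpos_of_nonneg_of_nonpos h.2.1.le (neg_nonpos.2 (mul_nonneg
          (Finset.sum_nonneg h.1) (Finset.sum_nonneg fun i hi => mul_nonneg (h.1 i hi)
            (mul_nonneg (hpos i hi) (reProd_self_nonneg _ _)))))

theorem SepFamily.linProd_ne_zero {q : ℝ} {s t : ℕ → ℝ} {S : Finset ℕ} (h : SepFamily q s t S) :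
    linProd s t S ≠ 0 := by
  refine Finset.prod_ne_zero_iff.2 fun i hi h0 => ?_
  have h1 := congrArg (fun P => coeff P 0) h0
  have h2 := congrArg (fun P => coeff P 1) h0
  simp at h1 h2
  rcases h.1 i hi with h3 | ⟨-, h3⟩
  · exact one_ne_zero (h3.symm.trans h1)
  · exact one_ne_zero (h3.symm.trans h2)

theorem Rpoly_eq_linProd (m : ℕ) (r : ℝ) :
    Rpoly m r = linProd (fun i => r ^ i) (fun _ => 1) (Finset.range m) :=
  Finset.prod_congr rfl fun i _ => by rw [C_1, add_comm]

theorem convL_X_pow (n : ℕ) (q : ℝ) (k : ℕ) (H : ℝ[X]) :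
    convL n q (X ^ k) H = C (H.coeff k / qBinom n k q) * X ^ k := by
  ext i
  rw [coeff_convL, coeff_C_mul_X_pow, coeff_X_pow]
  split_ifs with h
  · rw [h, one_mul]
  · simp

theorem pow_separated {r q : ℝ} (hr : 0 < r) (hrq : r < q) (hq1 : q ≤ 1) {i j : ℕ} (hij : i < j) :
    r ^ j < q * r ^ i := by
  calc r ^ j ≤ r ^ (i + 1) := pow_le_pow_of_le_one hr.le (by linarith) hij
    _ = r * r ^ i := pow_succ' r i
    _ < q * r ^ i := mul_lt_mul_of_pos_right hrq (by positivity)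

theorem wronskian_Rpoly_neg {z : ℂ} {ω : ℝ[X] →ₗ[ℝ] ℝ[X] →ₗ[ℝ] ℝ} (hω : IsWronskian z ω)
    (hz : z ≠ 0) {r q : ℝ} (hr : 0 < r) (hrq : r < q) (hq1 : q ≤ 1) {m : ℕ} {s t : ℕ → ℝ}
    {U : Finset ℕ} (hU : SepFamily q s t U) (hUm : U.card + 1 = m) :
    ω (convL m q (Rpoly m r) (linProd s t U)) (convL m q (Rpoly m r) (X * linProd s t U)) < 0 := by
  have hq : 0 < q := hr.trans hrq
  have hr1 : r < 1 := hrq.trans_le hq1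
  set σ : ℕ → ℝ := fun i => r ^ i with hσ
  set τ : ℕ → ℝ := fun _ => 1 with hτ
  have hlt : ∀ i j : ℕ, i ≠ j → |σ i| < q * |σ j| ∨ |σ j| < q * |σ i| := fun i j hij => by
    simp only [hσ, abs_of_pos (pow_pos hr _)]
    rcases lt_or_gt_of_ne hij with h | h
    · exact Or.inr (pow_separated hr hrq hq1 h)
    · exact Or.inl (pow_separated hr hrq hq1 h)
  have hcard : (Finset.range m).card = m := Finset.card_range m
  have hσ0 : ∀ i ∈ Finset.range m, σ i ≠ 0 := fun i _ => (pow_pos hr i).ne'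
  have hinj : Set.InjOn σ (Finset.range m) := fun i _ j _ hij =>
    pow_right_injective₀ hr hr1.ne hij
  have hsep : SepFamily q σ τ (Finset.range m) :=
    ⟨fun i _ => Or.inl rfl, fun i _ j _ hij _ _ _ => (hlt i j hij).imp le_of_lt le_of_lt⟩
  obtain ⟨β, b, h, hβ⟩ := exists_isRep_pos (q := q) (s := σ) (t := τ) hq hq1
    (Finset.card_pos.1 (by omega)) (fun _ _ => rfl) hσ0 hinj fun i _ j _ hij => hlt i j hij
  have hd := linProd_natDegree_le s t U
  rw [Rpoly_eq_linProd]
  have hle := h.wronskian_X_mul_le hω (H := linProd s t U) (by omega)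
    fun i hi j hj hij W hW => by
      have hc := card_erase_erase hi hj hij
      have hc1 := Finset.one_lt_card.2 ⟨i, hi, j, hj, hij⟩
      rw [hcard] at hc hW hc1 ⊢
      obtain ⟨k, rfl⟩ : ∃ k, m = k + 2 := ⟨m - 2, by omega⟩
      exact (wronskian_convL_nonpos hω hq hq1 k hU (hsep.erase_erase i j)).1 (by omega) (by omega)
        (fun l _ => mul_nonneg (pow_pos hr l).le zero_le_one) W hW
  rw [hcard] at hle
  refine hle.trans_lt (mul_neg_of_pos_of_neg h.2.1 (neg_neg_iff_pos.2 (mul_pos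
    (Finset.sum_pos hβ (Finset.card_pos.1 (by omega))) ?_)))
  have hnn : ∀ i ∈ Finset.range m, 0 ≤ β i * (σ i * τ i *
      reProd z (convL (m - 1) q (linProd σ τ ((Finset.range m).erase i)) (linProd s t U))
        (convL (m - 1) q (linProd σ τ ((Finset.range m).erase i)) (linProd s t U))) :=
    fun i hi => mul_nonneg (h.1 i hi)
      (mul_nonneg (mul_nonneg (pow_pos hr i).le zero_le_one) (reProd_self_nonneg _ _))
  refine lt_of_le_of_ne (Finset.sum_nonneg hnn) fun h0 => hU.linProd_ne_zero ?_
  have hv : ∀ i ∈ Finset.range m,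
      aeval z (convL (m - 1) q (linProd σ τ ((Finset.range m).erase i)) (linProd s t U)) = 0 :=
    fun i hi => by
      have h1 := (Finset.sum_eq_zero_iff_of_nonneg hnn).1 h0.symm i hi
      simpa [(hβ i hi).ne', hσ0 i hi, reProd_self, hτ] using h1
  ext k
  rw [coeff_zero]
  rcases lt_or_ge k m with hk | hk
  · have hL := lagrange_linProd (s := σ) (t := τ) (S := Finset.range m) (fun _ _ => rfl) hσ0 hinj
      (P := X ^ k) (by rw [hcard, degree_X_pow]; exact_mod_cast hk)
    have h1 : aeval z (convL (m - 1) q (X ^ k) (linProd s t U)) = 0 := by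
      rw [hL, convL_sum_left, map_sum]
      exact Finset.sum_eq_zero fun i hi => by rw [map_smul, hv i hi, smul_zero]
    rw [convL_X_pow] at h1
    simpa [hz, (qBinom_pos hq (n := m - 1) (k := k) (by omega)).ne'] using h1
  · exact coeff_eq_zero_of_natDegree_lt (by omega)

/-- The Wronskian at a real point. -/
noncomputable def wronskianAt (x : ℝ) : ℝ[X] →ₗ[ℝ] ℝ[X] →ₗ[ℝ] ℝ :=
  LinearMap.mk₂ ℝ (fun f g => (derivative f * g - f * derivative g).eval x)
    (fun f g h => by simp; ring) (fun c f g => by simp; ring)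
    (fun f g h => by simp; ring) (fun c f g => by simp; ring)

theorem wronskianAt_apply (x : ℝ) (f g : ℝ[X]) :
    wronskianAt x f g = (derivative f * g - f * derivative g).eval x := rfl

theorem aeval_ofReal (x : ℝ) (f : ℝ[X]) : aeval (x : ℂ) f = ((f.eval x : ℝ) : ℂ) := by
  rw [← Complex.coe_algebraMap, aeval_algebraMap_apply]
  simp

theorem isWronskian_wronskianAt (x : ℝ) : IsWronskian (x : ℂ) (wronskianAt x) where
  antisymm f g := by simp only [wronskianAt_apply, eval_sub, eval_mul]; ring
  mul_X f g := by
    simp only [wronskianAt_apply, reProd, aeval_ofReal, Complex.conj_ofReal, ← Complex.ofReal_mul,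
      Complex.ofReal_re]
    simp
    ring
  im_mul f g := by
    simp only [aeval_ofReal, Complex.conj_ofReal, ← Complex.ofReal_mul, Complex.ofReal_im,
      zero_mul]

/-- The normalised imaginary part of `f z * conj (g z)`. -/
noncomputable def imProd (z : ℂ) : ℝ[X] →ₗ[ℝ] ℝ[X] →ₗ[ℝ] ℝ :=
  LinearMap.mk₂ ℝ (fun f g => (aeval z f * (starRingEnd ℂ) (aeval z g)).im / z.im)
    (fun f g h => by simp; ring) (fun c f g => by simp; ring)
    (fun f g h => by simp; ring) (fun c f g => by simp; ring)

theorem imProd_apply (z : ℂ) (f g : ℝ[X]) :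
    imProd z f g = (aeval z f * (starRingEnd ℂ) (aeval z g)).im / z.im := rfl

theorem isWronskian_imProd {z : ℂ} (hz : z.im ≠ 0) : IsWronskian z (imProd z) where
  antisymm f g := by simp only [imProd_apply, Complex.mul_im, Complex.conj_re, Complex.conj_im]; ring
  mul_X f g := by
    simp only [imProd_apply, reProd, map_mul, aeval_X, Complex.mul_im, Complex.mul_re,
      Complex.conj_re, Complex.conj_im]
    field_simp
    ring
  im_mul f g := by rw [imProd_apply, mul_div_cancel₀ _ hz]

theorem realRooted_of_wronskian {K A B : ℝ[X]} {c : ℝ} (hc : 0 < c) (hK : K = A + C c * (X * B))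
    (hneg : ∀ z : ℂ, z.im ≠ 0 → imProd z B A < 0) : RealRooted K := by
  by_cases h0 : K = 0
  · exact Or.inl h0
  refine Or.inr ?_
  rw [← splits_iff_card_roots]
  refine Splits.of_splits_map (algebraMap ℝ ℂ) (IsAlgClosed.splits _) fun z hz => ?_
  have hz0 : aeval z K = 0 := by
    have := (mem_roots'.1 hz).2
    rwa [IsRoot, eval_map_algebraMap] at this
  by_cases him : z.im = 0
  · exact ⟨z.re, Complex.ext rfl (by simp [him])⟩
  · exfalso
    have h1 := hneg z him
    have h2 : aeval z A = -(c * (z * aeval z B)) := by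
      rw [hK] at hz0
      simp only [map_add, map_mul, aeval_C, aeval_X, Complex.coe_algebraMap] at hz0
      exact eq_neg_of_add_eq_zero_left hz0
    have h3 : (aeval z B * (starRingEnd ℂ) (aeval z A)).im
        = c * z.im * Complex.normSq (aeval z B) := by
      rw [h2]
      simp [Complex.normSq_apply, Complex.mul_im, Complex.mul_re]
      ring
    rw [imProd_apply, h3, mul_right_comm, mul_div_assoc, div_self him, mul_one] at h1
    exact absurd h1 (not_lt.2 (mul_nonneg hc.le (Complex.normSq_nonneg _)))

theorem derivative_mul_pos {K A B : ℝ[X]} {c x : ℝ} (hc : 0 < c) (hK : K = A + C c * (X * B))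
    (hneg : wronskianAt x B A < 0) (hx : K.eval x = 0) :
    0 < (derivative K).eval x * B.eval x := by
  rw [wronskianAt_apply] at hneg
  rw [hK] at hx ⊢
  simp at hx hneg ⊢
  have h1 : A.eval x = -(c * (x * B.eval x)) := by linarith
  rw [h1] at hneg
  nlinarith [mul_nonneg hc.le (sq_nonneg (B.eval x))]

theorem exists_root_Ioo {P : ℝ[X]} {a b : ℝ} (hab : a < b) (h : P.eval a * P.eval b < 0) :
    ∃ x ∈ Set.Ioo a b, P.eval x = 0 := by
  rcases mul_neg_iff.1 h with ⟨h1, h2⟩ | ⟨h1, h2⟩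
  · exact intermediate_value_Ioo' hab.le P.continuousOn ⟨h2, h1⟩
  · exact intermediate_value_Ioo hab.le P.continuousOn ⟨h1, h2⟩

theorem derivative_mul_derivative_neg {K : ℝ[X]} {a b : ℝ} (hab : a < b) (ha : K.eval a = 0)
    (hb : K.eval b = 0) (ha' : (derivative K).eval a ≠ 0) (hb' : (derivative K).eval b ≠ 0)
    (h : ∀ x ∈ Set.Ioo a b, K.eval x ≠ 0) :
    (derivative K).eval a * (derivative K).eval b < 0 := by
  obtain ⟨P, rfl⟩ := dvd_iff_isRoot.2 ha
  have hb2 : P.eval b = 0 := by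
    simpa [sub_eq_zero, hab.ne'] using hb
  obtain ⟨M, rfl⟩ := dvd_iff_isRoot.2 hb2
  simp at ha' hb' ⊢
  rcases lt_or_gt_of_ne (mul_ne_zero ha'.2 hb'.2) with hM | hM
  · obtain ⟨x, hx, hx0⟩ := exists_root_Ioo hab hM
    exact absurd (by simp [hx0]) (h x hx)
  · have : 0 < (b - a) * (b - a) := by have := sub_pos.2 hab; positivity
    nlinarith [mul_pos this hM]

theorem pos_roots_separated {K A B : ℝ[X]} {c r : ℝ} (hr : 0 < r) (hc : 0 < c) (hcr : c < r⁻¹)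
    (hK : K = A + C c * (X * B)) (hL : K.comp (C r⁻¹ * X) = A + C r⁻¹ * (X * B))
    (hneg : ∀ x : ℝ, 0 < x → wronskianAt x B A < 0) {x y : ℝ} (hx : x ∈ K.roots)
    (hy : y ∈ K.roots) (hx0 : 0 < x) (hxy : x < y) : x / y < r := by
  have hK0 : K ≠ 0 := (mem_roots'.1 hx).1
  by_contra hcon
  rw [not_lt, le_div_iff₀ (hx0.trans hxy)] at hcon
  set T : Finset ℝ := K.roots.toFinset.filter
    fun v => ∃ u, K.eval u = 0 ∧ 0 < u ∧ u < v ∧ r * v ≤ u with hT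
  have hmem : ∀ v, v ∈ T ↔ K.eval v = 0 ∧ ∃ u, K.eval u = 0 ∧ 0 < u ∧ u < v ∧ r * v ≤ u :=
    fun v => by simp [hT, hK0]
  have hTne : T.Nonempty :=
    ⟨y, (hmem y).2 ⟨(mem_roots'.1 hy).2, x, (mem_roots'.1 hx).2, hx0, hxy, hcon⟩⟩
  obtain ⟨v, hv, hvmax⟩ := T.exists_max_image id hTne
  obtain ⟨hv0, u', hu', hu'0, hu'v, hru'⟩ := (hmem v).1 hv
  obtain ⟨u, hu, humax⟩ := (K.roots.toFinset.filter fun w => w < v).exists_max_image id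
    ⟨u', by simpa [hK0, hu'v] using hu'⟩
  obtain ⟨hu0, huv⟩ : K.eval u = 0 ∧ u < v := by simpa [hK0] using hu
  have hu'u : u' ≤ u := humax u' (by simpa [hK0, hu'v] using hu')
  have hupos : 0 < u := hu'0.trans_le hu'u
  have hgap : ∀ w ∈ Set.Ioo u v, K.eval w ≠ 0 := fun w hw hw0 =>
    absurd (humax w (by simpa [hK0, hw.2] using hw0)) (not_le.2 hw.1)
  have h1 := derivative_mul_pos hc hK (hneg u hupos) hu0
  have h2 := derivative_mul_pos hc hK (hneg v (hupos.trans huv)) hv0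
  have h3 := derivative_mul_derivative_neg huv hu0 hv0 (left_ne_zero_of_mul h1.ne')
    (left_ne_zero_of_mul h2.ne') hgap
  have hB : B.eval u * B.eval v < 0 := by
    by_contra h
    nlinarith [mul_pos h1 h2, mul_nonneg (neg_nonneg.2 h3.le) (not_lt.1 h)]
  have hLe : ∀ w, K.eval w = 0 → (K.comp (C r⁻¹ * X)).eval w = (r⁻¹ - c) * w * B.eval w :=
    fun w hw => by
      rw [hL]
      rw [hK] at hw
      simp at hw ⊢
      linear_combination hw
  obtain ⟨w, hw, hw0⟩ := exists_root_Ioo (P := K.comp (C r⁻¹ * X)) huv (by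
    rw [hLe u hu0, hLe v hv0]
    have : 0 < ((r⁻¹ - c) * u) * ((r⁻¹ - c) * v) := by
      have := sub_pos.2 hcr
      have := hupos.trans huv
      positivity
    nlinarith [mul_neg_of_pos_of_neg this hB])
  have hw1 : K.eval (r⁻¹ * w) = 0 := by simpa using hw0
  have hvw : v < r⁻¹ * w := by
    rw [lt_inv_mul_iff₀ hr]
    linarith [hw.1]
  refine absurd (hvmax (r⁻¹ * w) ((hmem _).2 ⟨hw1, v, hv0, hupos.trans huv, hvw, ?_⟩))
    (not_le.2 hvw)
  rw [mul_inv_cancel_left₀ hr.ne']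
  exact hw.2.le

theorem strictLogSep_of_wronskian {K A B : ℝ[X]} {c r : ℝ} (hr : 0 < r) (hc : 0 < c)
    (hcr : c < r⁻¹) (hK : K = A + C c * (X * B))
    (hL : K.comp (C r⁻¹ * X) = A + C r⁻¹ * (X * B))
    (hneg : ∀ x : ℝ, x ≠ 0 → wronskianAt x B A < 0) : StrictLogSep r K.roots := by
  refine ⟨fun x hx hx0 hcount => ?_, fun x hx y hy hxy => ?_⟩
  · rw [count_roots] at hcount
    have h1 := (one_lt_rootMultiplicity_iff_isRoot (mem_roots'.1 hx).1).1 hcount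
    have h2 := derivative_mul_pos hc hK (hneg x hx0) h1.1
    rw [h1.2, zero_mul] at h2
    exact absurd h2 (lt_irrefl _)
  · rcases hxy with ⟨h1, h2⟩ | ⟨h1, h2⟩
    · have hm : ∀ w ∈ K.roots, -w ∈ (K.comp (-X)).roots := fun w hw => by
        obtain ⟨hw0, hw⟩ := mem_roots'.1 hw
        refine mem_roots'.2 ⟨fun h => hw0 ?_, by simpa [IsRoot] using hw⟩
        simpa using congrArg (fun P => P.comp (-X)) h
      rw [← neg_div_neg_eq]
      refine pos_roots_separated (K := K.comp (-X)) (A := A.comp (-X)) (B := -B.comp (-X)) hr hc hcr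
        ?_ ?_ ?_ (hm x hx) (hm y hy) (by linarith) (by linarith)
      · rw [hK]; simp
      · have := congrArg (fun P => P.comp (-X)) hL
        simp only [comp_assoc] at this ⊢
        simpa using this
      · intro w hw
        have := hneg (-w) (by linarith)
        simp only [wronskianAt_apply] at this ⊢
        simpa [derivative_comp] using this
    · exact pos_roots_separated hr hc hcr hK hL (fun w hw => hneg w hw.ne') hx hy h1 h2

theorem roots_map_prod {M : Type*} [CommMonoid M] (m : Multiset ℝ) (f : ℝ → M) :
    (m.map f).prod = ∏ i ∈ Finset.range m.toList.length, f (m.toList.getD i 0) := by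
  conv_lhs => rw [← Multiset.coe_toList m]
  rw [Multiset.map_coe, Multiset.prod_coe, ← Fin.prod_univ_fun_getElem, Finset.prod_range]
  exact Finset.prod_congr rfl fun i _ => by
    rw [List.getD_eq_getElem _ _ i.2]

theorem LogSep.abs_le {q : ℝ} {m : Multiset ℝ} (h : LogSep q m) {i j : ℕ}
    (hi : i < m.toList.length) (hj : j < m.toList.length) (hij : i ≠ j)
    (hpos : 0 < m.toList.getD i 0 * m.toList.getD j 0) :
    |m.toList.getD i 0| ≤ q * |m.toList.getD j 0| ∨
      |m.toList.getD j 0| ≤ q * |m.toList.getD i 0| := by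
  have hmem : ∀ k < m.toList.length, m.toList.getD k 0 ∈ m := fun k hk => by
    rw [List.getD_eq_getElem _ _ hk, ← Multiset.mem_toList]
    exact List.getElem_mem hk
  have hcount : m.toList.getD i 0 = m.toList.getD j 0 → 2 ≤ m.count (m.toList.getD i 0) :=
    fun h => by
      rw [List.getD_eq_getElem _ _ hi, List.getD_eq_getElem _ _ hj] at h
      rw [List.getD_eq_getElem _ _ hi]
      refine (?_ : 2 ≤ m.toList.count m.toList[i]).trans_eq
        (by rw [← Multiset.coe_count, Multiset.coe_toList])
      rw [← List.duplicate_iff_two_le_count, List.duplicate_iff_exists_distinct_get]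
      rcases lt_or_gt_of_ne hij with hlt | hlt
      · exact ⟨⟨i, hi⟩, ⟨j, hj⟩, hlt, rfl, h⟩
      · exact ⟨⟨j, hj⟩, ⟨i, hi⟩, hlt, h, rfl⟩
  obtain ⟨h1, h2⟩ := h
  have hmi := hmem i hi
  have hmj := hmem j hj
  generalize m.toList.getD i 0 = a at *
  generalize m.toList.getD j 0 = b at *
  have key : ∀ a b : ℝ, a ∈ m → b ∈ m → 0 < a * b → |a| < |b| → |a| ≤ q * |b| := by
    intro a b ha hb hab hlt
    have hb0 : 0 < |b| := (abs_nonneg a).trans_lt hlt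
    rw [← div_le_iff₀ hb0, ← abs_div, abs_of_pos (by
      rcases mul_pos_iff.1 hab with ⟨h3, h4⟩ | ⟨h3, h4⟩
      · exact div_pos h3 h4
      · exact div_pos_of_neg_of_neg h3 h4)]
    refine h2 a ha b hb ?_
    rcases mul_pos_iff.1 hab with ⟨h3, h4⟩ | ⟨h3, h4⟩
    · rw [abs_of_pos h3, abs_of_pos h4] at hlt
      exact Or.inr ⟨h3, hlt⟩
    · rw [abs_of_neg h3, abs_of_neg h4] at hlt
      exact Or.inl ⟨by linarith, h3⟩
  rcases lt_trichotomy |a| |b| with hlt | heq | hlt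
  · exact Or.inl (key a b hmi hmj hpos hlt)
  · have hab : a = b := by
      rcases abs_eq_abs.1 heq with h3 | h3
      · exact h3
      · rw [h3] at hpos; nlinarith [sq_nonneg b]
    have hq := h1 a hmi (left_ne_zero_of_mul hpos.ne') (hcount hab)
    rw [heq]
    exact Or.inl (le_mul_of_one_le_left (abs_nonneg _) hq)
  · exact Or.inr (key b a hmj hmi (by rwa [mul_comm]) hlt)

theorem exists_linProd {n : ℕ} {q : ℝ} {F : ℝ[X]} (hF : memRbar n q F) (h0 : F ≠ 0) :
    ∃ c s t, c ≠ 0 ∧ F = C c * linProd s t (Finset.range n) ∧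
      SepFamily q s t (Finset.range n) ∧
      (OnlyNonposRoots F → ∀ i, 0 ≤ s i ∧ 0 ≤ t i) := by
  obtain ⟨hd, hr, hsep⟩ := hF
  have hr := hr.resolve_left h0
  set N := F.roots.toList.length with hN
  set a : ℕ → ℝ := fun i => F.roots.toList.getD i 0 with ha
  have hNn : N ≤ n := by rw [hN, Multiset.length_toList, hr]; exact hd
  set s : ℕ → ℝ := fun i => if N ≤ i then 0 else if a i = 0 then 1 else -(a i)⁻¹ with hs
  set t : ℕ → ℝ := fun i => if i < N ∧ a i = 0 then 0 else 1 with ht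
  set κ : ℕ → ℝ := fun i => if a i = 0 then 1 else -a i with hκ
  have hκ0 : ∀ i, κ i ≠ 0 := fun i => by
    simp only [hκ]; split_ifs with h
    · exact one_ne_zero
    · exact neg_ne_zero.2 h
  have hfac : ∀ i ∈ Finset.range N, X - C (a i) = C (κ i) * (C (s i) * X + C (t i)) := by
    intro i hi
    have hi := Finset.mem_range.1 hi
    by_cases h : a i = 0
    · simp [hs, ht, hκ, h, hi, not_le.2 hi]
    · simp only [hs, ht, hκ, h, not_le.2 hi, if_false, and_false, C_1]
      rw [mul_add, ← mul_assoc, ← C_mul, neg_mul_neg, mul_inv_cancel₀ h]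
      simp [sub_eq_add_neg]
  refine ⟨F.leadingCoeff * ∏ i ∈ Finset.range N, κ i, s, t,
    mul_ne_zero (leadingCoeff_ne_zero.2 h0) (Finset.prod_ne_zero_iff.2 fun i _ => hκ0 i),
    ?_, ⟨fun i _ => ?_, fun i _ j _ hij hti htj hpos => ?_⟩, fun hnp i => ?_⟩
  · conv_lhs => rw [← C_leadingCoeff_mul_prod_multiset_X_sub_C hr]
    rw [roots_map_prod, Finset.prod_congr rfl hfac, Finset.prod_mul_distrib, linProd,
      ← Finset.prod_subset (Finset.range_subset_range.2 hNn), C_mul, map_prod, mul_assoc]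
    intro i _ hi
    have hi : N ≤ i := by simpa using hi
    simp [hs, ht, hi, not_lt.2 hi]
  · by_cases h : i < N ∧ a i = 0
    · exact Or.inr ⟨if_pos h, by simp [hs, h.2, not_le.2 h.1]⟩
    · exact Or.inl (if_neg h)
  · have hlt : ∀ k, s k ≠ 0 → k < N := fun k hk => by
      by_contra h
      exact hk (if_pos (not_lt.1 h))
    have hi := hlt i (left_ne_zero_of_mul hpos.ne')
    have hj := hlt j (right_ne_zero_of_mul hpos.ne')
    have hne : ∀ k, k < N → t k = 1 → a k ≠ 0 := fun k hk h1 h2 => by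
      simp [ht, hk, h2] at h1
    have hsk : ∀ k, k < N → a k ≠ 0 → s k = -(a k)⁻¹ := fun k hk h => by
      simp [hs, not_le.2 hk, h]
    have hai := hne i hi hti
    have haj := hne j hj htj
    rw [hsk i hi hai, hsk j hj haj] at hpos ⊢
    have hpos' : 0 < a i * a j := by
      rw [neg_mul_neg, ← mul_inv] at hpos
      exact inv_pos.1 hpos
    have hai' := abs_pos.2 hai
    have haj' := abs_pos.2 haj
    rw [abs_neg, abs_neg, abs_inv, abs_inv]
    refine (hsep.abs_le hi hj hij hpos').symm.imp (fun h => ?_) fun h => ?_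
    · rw [inv_le_iff_one_le_mul₀ hai', ← div_eq_mul_inv, div_mul_eq_mul_div, le_div_iff₀ haj',
        one_mul]
      exact h
    · rw [inv_le_iff_one_le_mul₀ haj', ← div_eq_mul_inv, div_mul_eq_mul_div, le_div_iff₀ hai',
        one_mul]
      exact h
  · have hle : i < N → a i ≤ 0 := fun hi => hnp _ (by
      simp only [ha]
      rw [List.getD_eq_getElem _ _ hi, ← Multiset.mem_toList]
      exact List.getElem_mem hi)
    constructor
    · simp only [hs]
      split_ifs with h1 h2
      · exact le_rfl
      · exact zero_le_one
      · exact neg_nonneg.2 (inv_nonpos.2 (hle (not_le.1 h1)))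
    · simp only [ht]
      split_ifs
      · exact le_rfl
      · exact zero_le_one

theorem IsRep.extremal_or_monomial {n : ℕ} {q b : ℝ} {s t β : ℕ → ℝ} (hq : 0 < q)
    (hsep : SepFamily q s t (Finset.range n)) (h : IsRep q s t (Finset.range n) β b)
    (hpair : ∀ i ∈ Finset.range n, ∀ j ∈ Finset.range n, 0 < β i → 0 < β j →
      s i * t j - s j * t i = 0) :
    (∃ a g, a ≠ 0 ∧ linProd s t (Finset.range n) = C g * (Rpoly n q).comp (C a * X)) ∨
      ∃ k g, linProd s t (Finset.range n) = C g * X ^ k := by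
  have hrep := h.2.2
  set L := linProd s t (Finset.range n) with hL
  simp only [Finset.card_range] at hrep
  obtain ⟨s₀, t₀, hst, hst'⟩ : ∃ s₀ t₀ : ℝ, (t₀ = 0 → s₀ ≠ 0) ∧
      ∀ i ∈ Finset.range n, t₀ * (β i * s i) = s₀ * (β i * t i) := by
    by_cases hex : ∃ j ∈ Finset.range n, 0 < β j
    · obtain ⟨j, hj, hβj⟩ := hex
      refine ⟨s j, t j, fun h0 => ?_, fun i hi => ?_⟩
      · rcases hsep.1 j hj with h1 | h1
        · simp [h0] at h1
        · simp [h1.2]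
      · rcases (h.1 i hi).eq_or_lt with h1 | h1
        · simp [← h1]
        · linear_combination β i * hpair i hi j hj h1 hβj
    · refine ⟨0, 1, fun h0 => absurd h0 one_ne_zero, fun i hi => ?_⟩
      have : β i = 0 := le_antisymm (not_lt.1 fun h1 => hex ⟨i, hi, h1⟩) (h.1 i hi)
      simp [this]
  have hsum : t₀ • ∑ i ∈ Finset.range n, (β i * s i) • linProd s t ((Finset.range n).erase i)
      = s₀ • ∑ i ∈ Finset.range n, (β i * t i) • linProd s t ((Finset.range n).erase i) := by
    rw [Finset.smul_sum, Finset.smul_sum]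
    exact Finset.sum_congr rfl fun i hi => by rw [smul_smul, smul_smul, hst' i hi]
  have hrec : ∀ k < n, t₀ * (L.coeff (k + 1) / qBinom n (k + 1) q)
      = b * s₀ * (L.coeff k / qBinom n k q) := by
    intro k hk
    obtain ⟨h1, h2⟩ := hrep (X ^ k) (by rwa [natDegree_X_pow])
    have h1 := congrArg (fun P => coeff P k) h1
    have h2 := congrArg (fun P => coeff P (k + 1)) h2
    have h3 := congrArg (fun P => coeff P k) hsum
    simp only [coeff_convL, coeff_smul, coeff_X_mul, smul_eq_mul, coeff_X_pow_self, mul_one]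
      at h1 h2 h3
    rw [h1, h2]
    linear_combination b / qBinom (n - 1) k q * h3
  have hdeg : ∀ k, n < k → L.coeff k = 0 := fun k hk =>
    coeff_eq_zero_of_natDegree_lt
      (((linProd_natDegree_le _ _ _).trans (Finset.card_range n).le).trans_lt hk)
  by_cases ht₀ : t₀ = 0
  · refine Or.inr ⟨n, L.coeff n, ?_⟩
    ext k
    rw [coeff_C_mul_X_pow]
    split_ifs with hk
    · rw [hk]
    · rcases lt_or_gt_of_ne hk with hk | hk
      · have := hrec k hk
        rw [ht₀, zero_mul] at this
        simpa [h.2.1.ne', hst ht₀, (qBinom_pos hq hk.le).ne'] using this.symm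
      · exact hdeg k hk
  · have hgeo : ∀ k ≤ n, L.coeff k / qBinom n k q = (b * s₀ / t₀) ^ k * L.coeff 0 := by
      intro k
      induction k with
      | zero => intro _; simp [qBinom_zero_right]
      | succ k ih =>
        intro hk
        have h1 := hrec k hk
        rw [ih (by omega)] at h1
        rw [pow_succ]
        field_simp at h1 ⊢
        linear_combination h1
    have hco : L = C (L.coeff 0) * (Rpoly n q).comp (C (b * s₀ / t₀) * X) := by
      ext k
      rw [coeff_C_mul, comp_C_mul_X_coeff']
      change _ = L.coeff 0 * (qBinom n k q * _)
      rcases le_or_gt k n with hk | hk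
      · have h1 := hgeo k hk
        rw [div_eq_iff (qBinom_pos hq hk).ne'] at h1
        rw [h1]; ring
      · rw [hdeg k hk, qBinom_eq_zero hk]; ring
    by_cases hs₀ : b * s₀ / t₀ = 0
    · refine Or.inr ⟨0, L.coeff 0, ?_⟩
      have : (Rpoly n q).comp (C (b * s₀ / t₀) * X) = 1 := by
        rw [hs₀, C_0, zero_mul, comp_zero, ← coeff_zero_eq_eval_zero]
        exact congrArg C (qBinom_zero_right n q)
      rw [this] at hco
      simpa using hco
    · exact Or.inl ⟨_, _, hs₀, hco⟩

theorem qHadamard_natDegree_le (n : ℕ) (q : ℝ) (F G : ℝ[X]) : (qHadamard n q F G).natDegree ≤ n :=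
  natDegree_le_iff_coeff_eq_zero.2 fun k hk => by
    rw [coeff_qHadamard, qBinom_eq_zero hk, div_zero]

theorem memR_C_mul_X_pow {n k : ℕ} {r g : ℝ} (h : (C g * X ^ k : ℝ[X]).natDegree ≤ n) :
    memR n r (C g * X ^ k) := by
  by_cases hg : g = 0
  · subst hg
    exact ⟨h, Or.inl (by simp), by simp [StrictLogSep]⟩
  have hroots : (C g * X ^ k : ℝ[X]).roots = k • {0} := by
    rw [roots_C_mul _ hg, roots_pow, roots_X]
  have hzero : ∀ x ∈ (C g * X ^ k : ℝ[X]).roots, x = 0 := fun x hx => by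
    rw [hroots] at hx
    exact Multiset.mem_singleton.1 (Multiset.mem_of_mem_nsmul hx)
  refine ⟨h, Or.inr ?_, fun x hx hx0 => absurd (hzero x hx) hx0, fun x hx y hy hxy => ?_⟩
  · rw [hroots, natDegree_C_mul_X_pow _ _ hg]; simp
  · rw [hzero x hx, hzero y hy] at hxy
    simp at hxy

theorem coeff_linProd_nonneg {s t : ℕ → ℝ} (h : ∀ i, 0 ≤ s i ∧ 0 ≤ t i) (S : Finset ℕ) (k : ℕ) :
    0 ≤ (linProd s t S).coeff k := by
  induction S using Finset.induction_on generalizing k with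
  | empty => rw [linProd, Finset.prod_empty, coeff_one]; split_ifs <;> norm_num
  | insert i S hi ih =>
    rw [linProd_insert s t hi, add_mul, mul_assoc, coeff_add, coeff_C_mul, coeff_C_mul]
    refine add_nonneg (mul_nonneg (h i).1 ?_) (mul_nonneg (h i).2 (ih k))
    cases k with
    | zero => simp
    | succ k => rw [coeff_X_mul]; exact ih k

theorem onlyNonposRoots_of_coeff_nonneg {P : ℝ[X]} (h : ∀ k, 0 ≤ P.coeff k) :
    OnlyNonposRoots P := by
  intro x hx
  obtain ⟨hP, hx0⟩ := mem_roots'.1 hx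
  by_contra hpos
  rw [not_le] at hpos
  rw [IsRoot, eval_eq_sum_range] at hx0
  have h1 := (Finset.sum_eq_zero_iff_of_nonneg fun i _ =>
    mul_nonneg (h i) (pow_pos hpos i).le).1 hx0 P.natDegree (by simp)
  exact mul_ne_zero (leadingCoeff_ne_zero.2 hP) (pow_pos hpos _).ne' h1

theorem Rpoly_comp_inv (n : ℕ) {r : ℝ} (hr : r ≠ 0) :
    (Rpoly (n + 1) r).comp (C r⁻¹ * X) = Rpoly n r + C r⁻¹ * (X * Rpoly n r) := by
  have h : ((Rpoly n r).comp (C r * X)).comp (C r⁻¹ * X) = Rpoly n r := by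
    rw [comp_assoc]
    have : (C r * X : ℝ[X]).comp (C r⁻¹ * X) = X := by
      rw [mul_comp, C_comp, X_comp, ← mul_assoc, ← C_mul, mul_inv_cancel₀ hr, C_1, one_mul]
    rw [this, comp_X]
  rw [Rpoly_succ', mul_comp, h]
  simp
  ring

theorem convL_comp (n : ℕ) (q a : ℝ) (F G : ℝ[X]) :
    (convL n q F G).comp (C a * X) = convL n q F (G.comp (C a * X)) := by
  ext k
  rw [comp_C_mul_X_coeff', coeff_convL, coeff_convL, comp_C_mul_X_coeff']
  ring

/-- The core of the theorem, for a product of linear forms of exact length `n`. -/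
theorem memR_qHadamard_linProd {n : ℕ} (hn : 1 ≤ n) {r q : ℝ} (hr : 0 < r) (hrq : r < q)
    (hq : q ≤ 1) {s t : ℕ → ℝ} (hsep : SepFamily q s t (Finset.range n)) {c : ℝ} (hc : c ≠ 0)
    (hne : ¬ Extremal n q (C c * linProd s t (Finset.range n))) :
    memR n r (qHadamard n q (C c * linProd s t (Finset.range n)) (Rpoly n r)) := by
  have hq0 : 0 < q := hr.trans hrq
  have hr1 : r < 1 := hrq.trans_le hq
  have hdeg := qHadamard_natDegree_le n q (C c * linProd s t (Finset.range n)) (Rpoly n r)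
  obtain ⟨β, b, h⟩ := exists_isRep hq0 hq (Finset.nonempty_range_iff.2 (by omega)) hsep
  by_cases hpair : ∀ i ∈ Finset.range n, ∀ j ∈ Finset.range n, 0 < β i → 0 < β j →
      s i * t j - s j * t i = 0
  · rcases h.extremal_or_monomial hq0 hsep hpair with ⟨a, g, ha, hL⟩ | ⟨k, g, hL⟩
    · refine absurd ⟨a, c * g, ha, mul_ne_zero hc fun hg => hsep.linProd_ne_zero ?_, ?_⟩ hne
      · rw [hL, hg, C_0, zero_mul]
      · rw [hL, C_mul, mul_assoc]
    · have hK : qHadamard n q (C c * linProd s t (Finset.range n)) (Rpoly n r)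
          = C (c * g * qBinom n k r / qBinom n k q) * X ^ k := by
        ext i
        rw [coeff_qHadamard, hL, ← mul_assoc, ← C_mul, coeff_C_mul_X_pow, coeff_C_mul_X_pow]
        split_ifs with hi
        · rw [hi]; rfl
        · simp
      rw [hK] at hdeg ⊢
      exact memR_C_mul_X_pow hdeg
  push Not at hpair
  obtain ⟨m, rfl⟩ : ∃ m, n = m + 1 := ⟨n - 1, by omega⟩
  obtain ⟨W, hW⟩ := exists_convL_X_mul (m + 1) q (linProd s t (Finset.range (m + 1))) (Rpoly m r)
  set L := linProd s t (Finset.range (m + 1)) with hL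
  have hneg : ∀ {z : ℂ} {ω : ℝ[X] →ₗ[ℝ] ℝ[X] →ₗ[ℝ] ℝ}, IsWronskian z ω → z ≠ 0 →
      ω (C c * W) (convL (m + 1) q (C c * L) (Rpoly m r)) < 0 := by
    intro z ω hω hz
    have hd := Rpoly_natDegree_le m r
    have hcard := Finset.card_range (m + 1)
    have := h.wronskian_neg hω (H := Rpoly m r) (W := W) (by omega) (by rw [hcard]; exact hW)
      (fun i hi j hj hij => by
        have hc := card_erase_erase hi hj hij
        have hc1 := Finset.one_lt_card.2 ⟨i, hi, j, hj, hij⟩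
        rw [hcard, Nat.add_sub_cancel]
        exact wronskian_Rpoly_neg hω hz hr hrq hq (hsep.erase_erase i j) (by omega))
      (by
        obtain ⟨i, hi, j, hj, h1, h2, h3⟩ := hpair
        exact ⟨i, hi, j, hj, h1, h2, h3⟩)
    rw [hcard] at this
    rw [← smul_eq_C_mul, ← smul_eq_C_mul, map_smul, map_smul, LinearMap.smul_apply,
      LinearMap.smul_apply, map_smul, smul_eq_mul, smul_eq_mul, ← mul_assoc]
    exact mul_neg_of_pos_of_neg (mul_self_pos.2 hc) this
  have hXW : convL (m + 1) q (C c * L) (X * Rpoly m r) = X * (C c * W) := by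
    rw [← smul_eq_C_mul, map_smul, LinearMap.smul_apply, hW, smul_eq_C_mul]; ring
  have hK : qHadamard (m + 1) q (C c * L) (Rpoly (m + 1) r)
      = convL (m + 1) q (C c * L) (Rpoly m r) + C (r ^ m) * (X * (C c * W)) := by
    rw [← hXW, ← smul_eq_C_mul (r ^ m), ← map_smul, ← map_add, ← convL_apply, Rpoly_succ,
      smul_eq_C_mul]
    congr 1
    ring
  have hKcomp : (qHadamard (m + 1) q (C c * L) (Rpoly (m + 1) r)).comp (C r⁻¹ * X)
      = convL (m + 1) q (C c * L) (Rpoly m r) + C r⁻¹ * (X * (C c * W)) := by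
    rw [← hXW, ← convL_apply, convL_comp, Rpoly_comp_inv m hr.ne', map_add,
      ← smul_eq_C_mul (p := X * Rpoly m r), map_smul, smul_eq_C_mul]
  have hrm : 0 < r ^ m := pow_pos hr m
  have hrm' : r ^ m < r⁻¹ :=
    (pow_le_one₀ hr.le hr1.le).trans_lt ((one_lt_inv₀ hr).2 hr1)
  exact ⟨hdeg,
    realRooted_of_wronskian hrm hK fun z hz =>
      hneg (isWronskian_imProd hz) fun h0 => hz (by rw [h0]; rfl),
    strictLogSep_of_wronskian hr hrm hrm' hK hKcomp fun x hx =>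
      hneg (isWronskian_wronskianAt x) (by exact_mod_cast hx)⟩

/-- for `0 < r < q ≤ 1`, if `F ∈ 𝓡̄_n(q)` is not extremal then
`F *_q^n R_n(r;·) ∈ 𝓡_n(r)`; if `F ∈ 𝓝̄_n(q)` is not extremal then
`F *_q^n R_n(r;·) ∈ 𝓝_n(r)`. -/
theorem stmt2 (n : ℕ) (hn : 1 ≤ n) (r q : ℝ) (hr : 0 < r) (hrq : r < q) (hq : q ≤ 1)
    (F : Polynomial ℝ) (hne : ¬ Extremal n q F) :
    (memRbar n q F → memR n r (qHadamard n q F (Rpoly n r))) ∧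
    (memNbar n q F → memN n r (qHadamard n q F (Rpoly n r))) := by
  by_cases h0 : F = 0
  · have hK : qHadamard n q F (Rpoly n r) = 0 := by
      ext k
      simp [coeff_qHadamard, h0]
    have hmem : memR n r (qHadamard n q F (Rpoly n r)) := by
      rw [hK]
      exact ⟨by simp, Or.inl rfl, by simp [StrictLogSep]⟩
    exact ⟨fun _ => hmem, fun _ => ⟨hmem, by rw [hK]; simp [OnlyNonposRoots]⟩⟩
  have key : memRbar n q F → memR n r (qHadamard n q F (Rpoly n r)) := fun hF => by
    obtain ⟨c, s, t, hc, rfl, hsep, -⟩ := exists_linProd hF h0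
    exact memR_qHadamard_linProd hn hr hrq hq hsep hc hne
  refine ⟨key, fun hF => ⟨key hF.1, ?_⟩⟩
  obtain ⟨c, s, t, hc, hFL, hsep, hnonneg⟩ := exists_linProd hF.1 h0
  have hK : qHadamard n q F (Rpoly n r)
      = C c * qHadamard n q (linProd s t (Finset.range n)) (Rpoly n r) := by
    ext k
    rw [hFL, coeff_C_mul, coeff_qHadamard, coeff_qHadamard, coeff_C_mul]
    ring
  rw [hK, OnlyNonposRoots, roots_C_mul _ hc]
  refine onlyNonposRoots_of_coeff_nonneg fun k => ?_
  rw [coeff_qHadamard]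
  rcases le_or_gt k n with hk | hk
  · exact div_nonneg (mul_nonneg (coeff_linProd_nonneg (hnonneg hF.2) _ k) (qBinom_pos hr hk).le)
      (qBinom_pos (hr.trans hrq) hk).le
  · rw [qBinom_eq_zero hk, div_zero]
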